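/- If c ≥ √2, then the traveling wave equation ΔU + ic ∂U/∂y₂ + U(1−|U|²) = 0 in ℝ² has no (nonconstant finite-energy) traveling wave solutions. -/

import Mathlib

noncomputable section

open scoped Topology ENNReal NNReal RealInnerProductSpace
open Filter MeasureTheory Metric

/-- Euclidean space `ℝ^d`. -/
abbrev Euc (d : ℕ) : Type := EuclideanSpace ℝ (Fin d)

/-- The `i`-th standard basis vector of `ℝ^d`. -/
noncomputable def basisVec {d : ℕ} (i : Fin d) : Euc d := EuclideanSpace.single i (1 : ℝ)

/-- The Laplacian of a function on `ℝ^d`, as a sum of second directional derivatives. -/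
noncomputable def lap {d : ℕ} {F : Type*} [NormedAddCommGroup F] [NormedSpace ℝ F]
    (f : Euc d → F) (x : Euc d) : F :=
  ∑ i : Fin d, fderiv ℝ (fun y => fderiv ℝ f y (basisVec i)) x (basisVec i)

/-- The divergence of a vector field on `ℝ^d`. -/
noncomputable def dvg {d : ℕ} (V : Euc d → Euc d) (x : Euc d) : ℝ :=
  ∑ i : Fin d, fderiv ℝ (fun y => V y i) x (basisVec i)

/-- The `d`-th standard unit vector `e_d` (the last coordinate direction). -/
noncomputable def eDir (d : ℕ) : Euc d :=
  if h : 0 < d then EuclideanSpace.single ⟨d - 1, by omega⟩ (1 : ℝ) else 0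

/-- The Japanese bracket `⟨x⟩ = √(1+|x|²)`. -/
noncomputable def jap {d : ℕ} (x : Euc d) : ℝ := Real.sqrt (1 + ‖x‖ ^ 2)

/-- A smooth bounded obstacle `Ω ⊆ ℝ^d`, together with its unit outer normal field `ν`
on `∂Ω`. -/
structure Obstacle (d : ℕ) where
  region : Set (Euc d)
  normal : Euc d → Euc d
  isOpen : IsOpen region
  bounded : Bornology.IsBounded region
  nonempty : region.Nonempty
  normal_unit : ∀ x ∈ frontier region, ‖normal x‖ = 1

/-- The closed exterior region `ℝ^d ∖ Ω`. -/
def Obstacle.ext {d : ℕ} (O : Obstacle d) : Set (Euc d) := (O.region)ᶜ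

/-- The open exterior region `ℝ^d ∖ closure Ω`. -/
def Obstacle.extOpen {d : ℕ} (O : Obstacle d) : Set (Euc d) := (closure O.region)ᶜ

/-- `Φ` is a classical solution of the irrotational subsonic flow equation past the
obstacle `Ω`, with far-field speed `δ` in the direction `e_d`:
`∇·((1−|∇Φ|²)∇Φ) = 0` in `ℝ^d ∖ Ω`, `∂Φ/∂ν = 0` on `∂Ω`, `∇Φ(x) → δ e_d` as `|x| → ∞`. -/
def IsFlowSolution {d : ℕ} (O : Obstacle d) (δ : ℝ) (Φ : Euc d → ℝ) : Prop :=
  ContDiffOn ℝ 2 Φ O.ext ∧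
  (∀ x ∈ O.extOpen, dvg (fun y => (1 - ‖gradient Φ y‖ ^ 2) • gradient Φ y) x = 0) ∧
  (∀ x ∈ frontier O.region, ⟪gradient Φ x, O.normal x⟫ = (0 : ℝ)) ∧
  Tendsto (fun x => gradient Φ x) (Filter.cocompact (Euc d)) (nhds (δ • eDir d))

/-- `u` is a smooth solution of the Gross–Pitaevskii obstacle problem
`ε²Δu + u(1−|u|²) = 0` in `ℝ^d ∖ Ω`, `∂u/∂ν = 0` on `∂Ω`. -/
def IsGPSolution {d : ℕ} (O : Obstacle d) (ε : ℝ) (u : Euc d → ℂ) : Prop :=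
  (∀ n : ℕ, ContDiffOn ℝ n u O.ext) ∧
  (∀ x ∈ O.extOpen, (ε ^ 2 : ℂ) * lap u x + u x * (1 - (‖u x‖ : ℂ) ^ 2) = 0) ∧
  (∀ x ∈ frontier O.region, fderiv ℝ u x (O.normal x) = 0)

/-- The family `(ρ_ε, Φ_ε)`, `0 < ε < ε₀`, is a vortex-free family of solutions of the
Gross–Pitaevskii obstacle problem: `u_ε = ρ_ε e^{iΦ_ε/ε}` solves the problem and
`ρ_ε → 1 − |∇Φ^δ|²`, `∇Φ_ε → ∇Φ^δ` uniformly on `ℝ² ∖ Ω` as `ε → 0⁺`. -/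
def IsVortexFreeFamily (O : Obstacle 2) (δ : ℝ) (Φδ : Euc 2 → ℝ) (ε₀ : ℝ)
    (ρ Φ : ℝ → Euc 2 → ℝ) : Prop :=
  (∀ ε : ℝ, 0 < ε → ε < ε₀ →
    IsGPSolution O ε (fun x => (ρ ε x : ℂ) * Complex.exp (Complex.I * ((Φ ε x / ε : ℝ) : ℂ)))) ∧
  TendstoUniformlyOn (fun ε x => gradient (Φ ε) x) (fun x => gradient Φδ x)
    (𝓝[>] (0 : ℝ)) O.ext ∧
  TendstoUniformlyOn (fun ε x => ρ ε x) (fun x => 1 - ‖gradient Φδ x‖ ^ 2)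
    (𝓝[>] (0 : ℝ)) O.ext

/-- First coordinate direction in `ℝ²`. -/
noncomputable def e1 : Euc 2 := basisVec (0 : Fin 2)

/-- Second coordinate direction in `ℝ²`. -/
noncomputable def e2 : Euc 2 := basisVec (1 : Fin 2)

/-- Reflection across the line `{y₁ = 0}` in `ℝ²`. -/
noncomputable def refl1 (y : Euc 2) : Euc 2 := y - (2 * y 0) • e1

/-- `U` is a (classical) traveling wave solution of the Gross–Pitaevskii equation
`ΔU + ic ∂U/∂y₂ + U(1−|U|²) = 0` in `ℝ²`. -/
def IsTravelingWave (c : ℝ) (U : Euc 2 → ℂ) : Prop :=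
  ContDiff ℝ 2 U ∧
  ∀ y : Euc 2, lap U y + Complex.I * (c : ℂ) * fderiv ℝ U y e2
    + U y * (1 - (‖U y‖ : ℂ) ^ 2) = 0

/-- The linearized operator `𝕃₀[φ] = Δφ + ic ∂φ/∂y₂ + (1−|U|²)φ − 2(U·φ)U`
around a traveling wave `U`, where `a · b = Re(a b̄)`. -/
noncomputable def linGP (c : ℝ) (U φ : Euc 2 → ℂ) (y : Euc 2) : ℂ :=
  lap φ y + Complex.I * (c : ℂ) * fderiv ℝ φ y e2 + (1 - (‖U y‖ : ℂ) ^ 2) * φ y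
    - 2 * (((U y * (starRingEnd ℂ) (φ y)).re : ℝ) : ℂ) * U y

/-- Nondegeneracy of a traveling wave `U`: the only bounded solutions of the linearized
equation in the half-plane `{y₁ > 0}` with Neumann condition on `{y₁ = 0}` are the
real linear combinations of `iU` and `∂U/∂y₂`. -/
def NondegenerateTW (c : ℝ) (U : Euc 2 → ℂ) : Prop :=
  ∀ φ : Euc 2 → ℂ, ContDiff ℝ 2 φ →
    (∀ y : Euc 2, 0 < y 0 → linGP c U φ y = 0) →
    (∀ y : Euc 2, y 0 = 0 → fderiv ℝ φ y e1 = 0) →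
    (∃ M : ℝ, ∀ y : Euc 2, 0 ≤ y 0 → ‖φ y‖ ≤ M) →
    ∃ β₁ β₂ : ℝ, ∀ y : Euc 2, 0 ≤ y 0 →
      φ y = (β₁ : ℂ) * (Complex.I * U y) + (β₂ : ℂ) * fderiv ℝ U y e2

/-- `w` is the degree-one Ginzburg–Landau vortex `w⁺(y) = S₀(|y|) e^{iθ}` in `ℝ²`. -/
def IsGLVortexPlus (w : Euc 2 → ℂ) : Prop :=
  ContDiff ℝ 2 w ∧
  (∀ y : Euc 2, lap w y + w y * (1 - (‖w y‖ : ℂ) ^ 2) = 0) ∧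
  ∃ S₀ : ℝ → ℝ, ∀ y : Euc 2, y ≠ 0 →
    w y = ((S₀ ‖y‖ / ‖y‖ : ℝ) : ℂ) * ((y 0 : ℂ) + Complex.I * (y 1 : ℂ))

/-- The Ginzburg–Landau energy `∫ (|∇U|²/2 + (1−|U|²)²/4)` on `ℝ²`. -/
noncomputable def glEnergy (U : Euc 2 → ℂ) : ℝ≥0∞ :=
  ∫⁻ y : Euc 2, ((‖fderiv ℝ U y‖₊ : ℝ≥0∞) ^ 2 / 2
    + (‖1 - ‖U y‖ ^ 2‖₊ : ℝ≥0∞) ^ 2 / 4)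

/-- The momentum (in the `y₂` direction) of a map `U : ℝ² → ℂ`. -/
noncomputable def momentum (U : Euc 2 → ℂ) : ℝ :=
  ∫ y : Euc 2, (Complex.I * fderiv ℝ U y e2 * (starRingEnd ℂ) (U y - 1)).re
/-- `W^{1,2}` Sobolev norm of a function over a set `S`. -/
noncomputable def sobW12 {d : ℕ} (S : Set (Euc d)) (ρ : Euc d → ℝ) : ℝ≥0∞ :=
  eLpNorm ρ 2 (volume.restrict S) + eLpNorm (fun y => gradient ρ y) 2 (volume.restrict S)

/-- `W^{2,4}` Sobolev norm of a function over a set `S`. -/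
noncomputable def sobW24 {d : ℕ} (S : Set (Euc d)) (ρ : Euc d → ℝ) : ℝ≥0∞ :=
  eLpNorm ρ 4 (volume.restrict S) + eLpNorm (fun y => gradient ρ y) 4 (volume.restrict S)
    + eLpNorm (fun y => fderiv ℝ (fun z => gradient ρ z) y) 4 (volume.restrict S)

/-- The norm `‖ρ‖_{*,1} = sup_y ‖ρ‖_{W^{2,4}(B₁(y)∩S)} + ‖ρ‖_{W^{1,2}(S)}`. -/
noncomputable def normStar1 {d : ℕ} (S : Set (Euc d)) (ρ : Euc d → ℝ) : ℝ≥0∞ :=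
  (⨆ y : Euc d, sobW24 (Metric.ball y 1 ∩ S) ρ) + sobW12 S ρ

/-- The norm `‖Φ‖_{*,2} = ‖∇Φ‖_{L²(S)} + ‖∇Φ‖_{L⁴(S)}`. -/
noncomputable def normStar2 {d : ℕ} (S : Set (Euc d)) (Φ : Euc d → ℝ) : ℝ≥0∞ :=
  eLpNorm (fun y => gradient Φ y) 2 (volume.restrict S)
    + eLpNorm (fun y => gradient Φ y) 4 (volume.restrict S)

/-- The norm `‖f‖_{**,1} = ‖f‖_{L²(S)}`. -/
noncomputable def normSS1 {d : ℕ} (S : Set (Euc d)) (f : Euc d → ℝ) : ℝ≥0∞ :=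
  eLpNorm f 2 (volume.restrict S)

/-- The norm `‖g‖_{**,2} = ‖g‖_{L²(S)} + ‖g‖_{L⁴(S)}`. -/
noncomputable def normSS2 {d : ℕ} (S : Set (Euc d)) (g : Euc d → Euc d) : ℝ≥0∞ :=
  eLpNorm g 2 (volume.restrict S) + eLpNorm g 4 (volume.restrict S)

/-- The linear operator
`L₁(ρ,Φ) = Δρ − 2a²ρ + 2a b·∇Φ` (with `a = ρ^δ+ρ₁` and `b = ∇_xΦ^δ` in stretched
variables). -/
noncomputable def L1op {d : ℕ} (a : Euc d → ℝ) (b : Euc d → Euc d)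
    (ρ Φ : Euc d → ℝ) (y : Euc d) : ℝ :=
  lap ρ y - 2 * (a y) ^ 2 * ρ y + 2 * a y * ⟪b y, gradient Φ y⟫

/-- The linear operator `L₂(ρ,Φ) = ∇·(a²∇Φ) + ∇·(2 a ρ b)`. -/
noncomputable def L2op {d : ℕ} (a : Euc d → ℝ) (b : Euc d → Euc d)
    (ρ Φ : Euc d → ℝ) (y : Euc d) : ℝ :=
  dvg (fun z => (a z) ^ 2 • gradient Φ z) y + dvg (fun z => (2 * a z * ρ z) • b z) y

/-- Supremum (in `ℝ≥0∞`) of a real-valued function over a set. -/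
noncomputable def supENN (S : Set (Euc 2)) (f : Euc 2 → ℝ) : ℝ≥0∞ :=
  ⨆ y ∈ S, ENNReal.ofReal (f y)

/-- Hölder seminorm of exponent `γ` over a set `S`. -/
noncomputable def holderSemiOn {F : Type*} [NormedAddCommGroup F] (γ : ℝ) (S : Set (Euc 2))
    (f : Euc 2 → F) : ℝ≥0∞ :=
  ⨆ x ∈ S, ⨆ y ∈ S, ENNReal.ofReal (‖f x - f y‖ / ‖x - y‖ ^ γ)

/-- `C^{2,γ}` Hölder norm over a set `S`. -/
noncomputable def holderC2 (γ : ℝ) (S : Set (Euc 2)) (f : Euc 2 → ℂ) : ℝ≥0∞ :=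
  supENN S (fun y => ‖f y‖) + supENN S (fun y => ‖fderiv ℝ f y‖)
    + supENN S (fun y => ‖fderiv ℝ (fun z => fderiv ℝ f z) y‖)
    + holderSemiOn γ S (fun y => fderiv ℝ (fun z => fderiv ℝ f z) y)

/-- `C^{0,γ}` Hölder norm over a set `S`. -/
noncomputable def holderC0 (γ : ℝ) (S : Set (Euc 2)) (f : Euc 2 → ℂ) : ℝ≥0∞ :=
  supENN S (fun y => ‖f y‖) + holderSemiOn γ S f

/-- The weighted norm `‖φ‖_*`: the `C^{2,γ}` norm of `φ` on `{|y| < R} ∩ D`, plus the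
weighted decay norms of `ψ₁, ∇ψ₁, ψ₂, ∇ψ₂` on `{|y| > R} ∩ D`, where `φ = iWψ`,
`ψ = ψ₁ + iψ₂`. -/
noncomputable def normStarTW (γ σ R : ℝ) (D : Set (Euc 2)) (W φ : Euc 2 → ℂ) : ℝ≥0∞ :=
  holderC2 γ (D ∩ {y | ‖y‖ < R}) φ
    + supENN (D ∩ {y | R < ‖y‖}) (fun y => |((φ y / (Complex.I * W y)).re)|)
    + supENN (D ∩ {y | R < ‖y‖})
        (fun y => jap y ^ (1 + σ) * ‖gradient (fun z => (φ z / (Complex.I * W z)).re) y‖)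
    + supENN (D ∩ {y | R < ‖y‖}) (fun y => jap y ^ (1 + σ) * |((φ y / (Complex.I * W y)).im)|)
    + supENN (D ∩ {y | R < ‖y‖})
        (fun y => jap y ^ (2 + σ) * ‖gradient (fun z => (φ z / (Complex.I * W z)).im) y‖)

/-- The interior norm `‖h‖_{**,i} = ‖iWh‖_{C^{0,γ}} + ‖⟨y⟩^{2+σ}h₁‖_∞ + ‖⟨y⟩^{1+σ}h₂‖_∞`
on `{|y| > R} ∩ D`. -/
noncomputable def normSSi (γ σ R : ℝ) (D : Set (Euc 2)) (W h : Euc 2 → ℂ) : ℝ≥0∞ :=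
  holderC0 γ (D ∩ {y | R < ‖y‖}) (fun y => Complex.I * W y * h y)
    + supENN (D ∩ {y | R < ‖y‖}) (fun y => jap y ^ (2 + σ) * |(h y).re|)
    + supENN (D ∩ {y | R < ‖y‖}) (fun y => jap y ^ (1 + σ) * |(h y).im|)

/-- The boundary norm `‖g‖_{**,b} = ‖⟨y⟩^{2+σ}g₁‖_{L^∞(∂)} + ‖⟨y⟩^{1+σ}g₂‖_{L^∞(∂)}`. -/
noncomputable def normSSb (σ : ℝ) (B : Set (Euc 2)) (g : Euc 2 → ℂ) : ℝ≥0∞ :=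
  supENN B (fun y => jap y ^ (2 + σ) * |(g y).re|)
    + supENN B (fun y => jap y ^ (1 + σ) * |(g y).im|)

/-- Dot product of the (complex) gradients of `f` and `g`: `∇f · ∇g`. -/
noncomputable def cgradDot (f g : Euc 2 → ℂ) (y : Euc 2) : ℂ :=
  ∑ j : Fin 2, fderiv ℝ f y (basisVec j) * fderiv ℝ g y (basisVec j)

/-- Dot product of a real vector `v` with the gradient of a complex function: `v · ∇g`. -/
noncomputable def vecDotC (v : Euc 2) (g : Euc 2 → ℂ) (y : Euc 2) : ℂ :=
  ∑ j : Fin 2, ((v j : ℝ) : ℂ) * fderiv ℝ g y (basisVec j)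

/-- The linear operator
`L̃_{ε,1}[ψ] = Δψ − 2iρ_ε²|W|²ψ₂ + (∇W/W)·∇ψ + 2i∇_xΦ_ε(x₀)·∇ψ`, at `x = x₀ + εy`. -/
noncomputable def Ltilde1 (ρe Φe : Euc 2 → ℝ) (x₀ : Euc 2) (ε : ℝ) (W : Euc 2 → ℂ)
    (ψ : Euc 2 → ℂ) (y : Euc 2) : ℂ :=
  lap ψ y - 2 * Complex.I * (((ρe (x₀ + ε • y)) ^ 2 * ‖W y‖ ^ 2 * (ψ y).im : ℝ) : ℂ)
    + (1 / W y) * cgradDot W ψ y + 2 * Complex.I * vecDotC (gradient Φe x₀) ψ y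

/-- The linear operator
`L̃_{ε,2}[ψ] = 2i(∇_xΦ_ε(x) − ∇_xΦ_ε(x₀))·∇ψ + 2ε ∇_x log ρ_ε(x)·∇ψ`, at `x = x₀ + εy`. -/
noncomputable def Ltilde2 (ρe Φe : Euc 2 → ℝ) (x₀ : Euc 2) (ε : ℝ)
    (ψ : Euc 2 → ℂ) (y : Euc 2) : ℂ :=
  2 * Complex.I * vecDotC (gradient Φe (x₀ + ε • y) - gradient Φe x₀) ψ y
    + 2 * ((ε : ℝ) : ℂ) * vecDotC (gradient (fun x => Real.log (ρe x)) (x₀ + ε • y)) ψ y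

/-- The rescaled Gross–Pitaevskii solution operator
`S[v] = Δv + vρ_ε²(1−|v|²) + 2ε∇_x log ρ_ε·∇v + 2i∇_xΦ_ε·∇v`, at `x = x₀ + εy`. -/
noncomputable def SOp (ρe Φe : Euc 2 → ℝ) (x₀ : Euc 2) (ε : ℝ)
    (v : Euc 2 → ℂ) (y : Euc 2) : ℂ :=
  lap v y + v y * (((ρe (x₀ + ε • y)) ^ 2 : ℝ) : ℂ) * ((1 - ‖v y‖ ^ 2 : ℝ) : ℂ)
    + 2 * ((ε : ℝ) : ℂ) * vecDotC (gradient (fun x => Real.log (ρe x)) (x₀ + ε • y)) v y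
    + 2 * Complex.I * vecDotC (gradient Φe (x₀ + ε • y)) v y

/-- The exterior of the shifted rescaled obstacle `Ω_{ε,x₀} = (Ω − x₀)/ε`. -/
def extD (O : Obstacle 2) (x₀ : Euc 2) (ε : ℝ) : Set (Euc 2) :=
  {y | x₀ + ε • y ∈ O.region}ᶜ

/-- The open exterior of the shifted rescaled obstacle. -/
def extDOpen (O : Obstacle 2) (x₀ : Euc 2) (ε : ℝ) : Set (Euc 2) :=
  {y | x₀ + ε • y ∈ closure O.region}ᶜ

/-- The boundary of the shifted rescaled obstacle. -/
def bdryD (O : Obstacle 2) (x₀ : Euc 2) (ε : ℝ) : Set (Euc 2) :=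
  {y | x₀ + ε • y ∈ frontier O.region}

/-- `Z₀ = iW/(1+|y|⁴)`. -/
noncomputable def Zfun0 (W : Euc 2 → ℂ) (y : Euc 2) : ℂ :=
  Complex.I * W y / (((1 + ‖y‖ ^ 4 : ℝ)) : ℂ)

/-- `Z₁ = (∂W/∂y₂)/(1+|y|⁴)`. -/
noncomputable def Zfun1 (W : Euc 2 → ℂ) (y : Euc 2) : ℂ :=
  fderiv ℝ W y e2 / (((1 + ‖y‖ ^ 4 : ℝ)) : ℂ)

/-- Divergence form complex operator `∇·(a∇v)` for a real weight `a`. -/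
noncomputable def divAC (a : Euc 2 → ℝ) (v : Euc 2 → ℂ) (y : Euc 2) : ℂ :=
  ∑ j : Fin 2, fderiv ℝ (fun z => ((a z : ℝ) : ℂ) * fderiv ℝ v z (basisVec j)) y (basisVec j)

namespace TW

/-- Partial derivative. -/
def D (k : Fin 2) (f : Euc 2 → ℝ) (y : Euc 2) : ℝ := fderiv ℝ f y (basisVec k)

lemma D_add {k : Fin 2} {f g : Euc 2 → ℝ} {y : Euc 2} (hf : Differentiable ℝ f)
    (hg : Differentiable ℝ g) : D k (fun z => f z + g z) y = D k f y + D k g y := by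
  simp only [D]
  rw [fderiv_fun_add (hf y) (hg y)]; rfl

lemma D_sub {k : Fin 2} {f g : Euc 2 → ℝ} {y : Euc 2} (hf : Differentiable ℝ f)
    (hg : Differentiable ℝ g) : D k (fun z => f z - g z) y = D k f y - D k g y := by
  simp only [D]
  rw [fderiv_fun_sub (hf y) (hg y)]; rfl

lemma D_mul {k : Fin 2} {f g : Euc 2 → ℝ} {y : Euc 2} (hf : Differentiable ℝ f)
    (hg : Differentiable ℝ g) :
    D k (fun z => f z * g z) y = D k f y * g y + f y * D k g y := by
  simp only [D]
  rw [fderiv_fun_mul (hf y) (hg y)]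
  simp [mul_comm]; ring

lemma D_const {k : Fin 2} {a : ℝ} {y : Euc 2} : D k (fun _ => a) y = 0 := by
  simp [D]

lemma D_cmul {k : Fin 2} {a : ℝ} {f : Euc 2 → ℝ} {y : Euc 2} (hf : Differentiable ℝ f) :
    D k (fun z => a * f z) y = a * D k f y := by
  rw [D_mul (by fun_prop) hf, D_const]; ring

lemma D_smooth {k : Fin 2} {n m : WithTop ℕ∞} {f : Euc 2 → ℝ} (hf : ContDiff ℝ n f)
    (h : m + 1 ≤ n) : ContDiff ℝ m (D k f) := by
  unfold D
  exact (hf.fderiv_right h).clm_apply contDiff_const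

lemma D_comm {f : Euc 2 → ℝ} (hf : ContDiff ℝ 2 f) (y : Euc 2) :
    D 0 (D 1 f) y = D 1 (D 0 f) y := by
  have h := (hf.contDiffAt (x := y)).isSymmSndFDerivAt (by simp)
  have hd : DifferentiableAt ℝ (fderiv ℝ f) y :=
    ((hf.fderiv_right (m := 1) (by norm_num)).differentiable (by norm_num)) y
  have key : ∀ k l : Fin 2, D k (D l f) y =
      fderiv ℝ (fderiv ℝ f) y (basisVec k) (basisVec l) := by
    intro k l
    unfold D
    rw [fderiv_clm_apply hd (by fun_prop)]
    simp
  rw [key, key]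
  exact h _ _

lemma D_supp {k : Fin 2} {f : Euc 2 → ℝ} (hf : HasCompactSupport f) :
    HasCompactSupport (D k f) := by
  exact hf.fderiv_apply ℝ (basisVec k)

lemma int_D {k : Fin 2} {f : Euc 2 → ℝ} (hf : ContDiff ℝ 1 f) (hs : HasCompactSupport f) :
    Integrable (D k f) ∧ ∫ y, D k f y = 0 := by
  have hi : Integrable (D k f) :=
    ((D_smooth (m := 0) hf (by norm_num)).continuous).integrable_of_hasCompactSupport (D_supp hs)
  refine ⟨hi, ?_⟩
  have := integral_mul_fderiv_eq_neg_fderiv_mul_of_integrable (μ := (volume : Measure (Euc 2)))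
    (f := fun _ : Euc 2 => (1:ℝ)) (g := f) (v := basisVec k) (by simp)
    (by simpa using (show Integrable (fun x => fderiv ℝ f x (basisVec k)) (volume : Measure (Euc 2)) from hi))
    (by simpa using hf.continuous.integrable_of_hasCompactSupport hs)
    (fun _ => by simp) (fun x _ => hf.differentiable (by norm_num) x)
  simpa [D] using this

/-- The main integral identity. -/
lemma main_id (c : ℝ) (p q φ : Euc 2 → ℝ) (hp : ContDiff ℝ 2 p) (hq : ContDiff ℝ 2 q)
    (hφ : ContDiff ℝ 4 φ) (hs : HasCompactSupport φ)
    (e1 : ∀ y, D 0 (D 0 p) y + D 1 (D 1 p) y - c * D 1 q y + p y * (1 - p y ^ 2 - q y ^ 2) = 0)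
    (e2 : ∀ y, D 0 (D 0 q) y + D 1 (D 1 q) y + c * D 1 p y + q y * (1 - p y ^ 2 - q y ^ 2) = 0) :
    ∫ y, ((1 - p y ^ 2 - q y ^ 2) *
        ((D 0 (D 0 (D 0 (D 0 φ))) y + D 1 (D 1 (D 0 (D 0 φ))) y
          + D 0 (D 0 (D 1 (D 1 φ))) y + D 1 (D 1 (D 1 (D 1 φ))) y)
          - 2 * (D 0 (D 0 φ) y + D 1 (D 1 φ) y) + c ^ 2 * D 1 (D 1 φ) y)
      + (2 * (D 0 p y ^ 2 + D 1 p y ^ 2 + D 0 q y ^ 2 + D 1 q y ^ 2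
              + (1 - p y ^ 2 - q y ^ 2) ^ 2) * (D 0 (D 0 φ) y + D 1 (D 1 φ) y)
        - 2 * D 0 (D 0 φ) y * (D 1 p y ^ 2 + D 1 q y ^ 2 - D 0 p y ^ 2 - D 0 q y ^ 2)
        + 4 * D 1 (D 0 φ) y * (D 0 p y * D 1 p y + D 0 q y * D 1 q y)
        - D 0 (D 0 φ) y * (1 - p y ^ 2 - q y ^ 2) ^ 2)) = 0 := by
  have hp0 : ContDiff ℝ 1 (D 0 p) := D_smooth hp (by norm_num)
  have hp1 : ContDiff ℝ 1 (D 1 p) := D_smooth hp (by norm_num)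
  have hq0 : ContDiff ℝ 1 (D 0 q) := D_smooth hq (by norm_num)
  have hq1 : ContDiff ℝ 1 (D 1 q) := D_smooth hq (by norm_num)
  have h3 : ∀ k, ContDiff ℝ 3 (D k φ) := fun k => D_smooth hφ (by norm_num)
  have h2 : ∀ k l, ContDiff ℝ 2 (D k (D l φ)) := fun k l => D_smooth (h3 l) (by norm_num)
  have h1 : ∀ k l m, ContDiff ℝ 1 (D k (D l (D m φ))) :=
    fun k l m => D_smooth (h2 l m) (by norm_num)
  have hp' : ContDiff ℝ 1 p := hp.of_le (by norm_num)
  have hq' : ContDiff ℝ 1 q := hq.of_le (by norm_num)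
  have h3' : ∀ k, ContDiff ℝ 1 (D k φ) := fun k => (h3 k).of_le (by norm_num)
  have h2' : ∀ k l, ContDiff ℝ 1 (D k (D l φ)) := fun k l => (h2 k l).of_le (by norm_num)
  have s1 : ∀ k, HasCompactSupport (D k φ) := fun k => D_supp hs
  have s2 : ∀ k l, HasCompactSupport (D k (D l φ)) := fun k l => D_supp (s1 l)
  have s3 : ∀ k l m, HasCompactSupport (D k (D l (D m φ))) := fun k l m => D_supp (s2 l m)
  -- abbreviations
  set W0 : Euc 2 → ℝ := fun y =>
    2 * (p y * D 0 p y + q y * D 0 q y) * (D 0 (D 0 φ) y + D 1 (D 1 φ) y)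
    + (1 - p y * p y - q y * q y) * (D 0 (D 0 (D 0 φ)) y + D 0 (D 1 (D 1 φ)) y)
    - 2 * c * ((p y * D 0 q y - q y * D 0 p y) * D 1 φ y
        + (p y * D 1 q y - q y * D 1 p y) * D 0 φ y)
    - 4 * ((1 / 2) * D 0 φ y * (D 1 p y * D 1 p y + D 1 q y * D 1 q y
          - D 0 p y * D 0 p y - D 0 q y * D 0 q y)
        + (1 / 4) * D 0 φ y * ((1 - p y * p y - q y * q y) * (1 - p y * p y - q y * q y)))
    with hW0
  set W1 : Euc 2 → ℝ := fun y =>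
    2 * (p y * D 1 p y + q y * D 1 q y) * (D 0 (D 0 φ) y + D 1 (D 1 φ) y)
    + (1 - p y * p y - q y * q y) * (D 1 (D 0 (D 0 φ)) y + D 1 (D 1 (D 1 φ)) y)
    - 2 * c * ((p y * D 1 q y - q y * D 1 p y) * D 1 φ y
        - (p y * D 0 q y - q y * D 0 p y) * D 0 φ y
        - (c / 2) * ((1 - p y * p y - q y * q y) * D 1 φ y))
    + 4 * (D 0 φ y * (D 0 p y * D 1 p y + D 0 q y * D 1 q y)) with hW1
  have cW0 : ContDiff ℝ 1 W0 := by
    have := h2' 0 0; have := h2' 1 1; have := h1 0 0 0; have := h1 0 1 1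
    have := h3' 0; have := h3' 1
    rw [hW0]; fun_prop
  have cW1 : ContDiff ℝ 1 W1 := by
    have := h2' 0 0; have := h2' 1 1; have := h1 1 0 0; have := h1 1 1 1
    have := h3' 0; have := h3' 1
    rw [hW1]; fun_prop
  have zt : ∀ (f : Euc 2 → ℝ) y, y ∉ tsupport φ → tsupport f ⊆ tsupport φ → f y = 0 :=
    fun f y hy hf => image_eq_zero_of_notMem_tsupport fun h => hy (hf h)
  have dt : ∀ (k : Fin 2) (f : Euc 2 → ℝ), tsupport (D k f) ⊆ tsupport f :=
    fun k f => tsupport_fderiv_apply_subset ℝ (basisVec k)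
  have t1 : ∀ k, tsupport (D k φ) ⊆ tsupport φ := fun k => dt _ _
  have t2 : ∀ k l, tsupport (D k (D l φ)) ⊆ tsupport φ := fun k l => (dt _ _).trans (t1 _)
  have t3 : ∀ k l m, tsupport (D k (D l (D m φ))) ⊆ tsupport φ :=
    fun k l m => (dt _ _).trans (t2 _ _)
  have sW0 : HasCompactSupport W0 := by
    refine HasCompactSupport.intro hs fun y hy => ?_
    simp only [hW0, zt _ y hy (t1 _), zt _ y hy (t2 _ _), zt _ y hy (t3 _ _ _)]; ring
  have sW1 : HasCompactSupport W1 := by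
    refine HasCompactSupport.intro hs fun y hy => ?_
    simp only [hW1, zt _ y hy (t1 _), zt _ y hy (t2 _ _), zt _ y hy (t3 _ _ _)]; ring
  obtain ⟨i0, z0⟩ := int_D (k := 0) cW0 sW0
  obtain ⟨i1, z1⟩ := int_D (k := 1) cW1 sW1
  have tot : ∫ y, (D 0 W0 y + D 1 W1 y) = 0 := by
    rw [integral_add i0 i1, z0, z1, add_zero]
  rw [← tot]
  congr 1
  ext y
  have dp := hp'.differentiable (by norm_num)
  have dq := hq'.differentiable (by norm_num)
  have dp0 := hp0.differentiable (by norm_num)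
  have dp1 := hp1.differentiable (by norm_num)
  have dq0 := hq0.differentiable (by norm_num)
  have dq1 := hq1.differentiable (by norm_num)
  have d0 := (h3' 0).differentiable (by norm_num)
  have d1 := (h3' 1).differentiable (by norm_num)
  have d00 := (h2' 0 0).differentiable (by norm_num)
  have d11 := (h2' 1 1).differentiable (by norm_num)
  have d000 := (h1 0 0 0).differentiable (by norm_num)
  have d011 := (h1 0 1 1).differentiable (by norm_num)
  have d100 := (h1 1 0 0).differentiable (by norm_num)
  have d111 := (h1 1 1 1).differentiable (by norm_num)
  have E1 := e1 y
  have E2 := e2 y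
  have cp := D_comm hp y
  have cq := D_comm hq y
  have cf := D_comm (hφ.of_le (by norm_num)) y
  rw [hW0, hW1]
  simp (disch := fun_prop) only [D_add, D_sub, D_mul, D_const]
  rw [cp, cq, cf]
  linear_combination (-2 * (D 0 (D 0 φ) y + D 1 (D 1 φ) y)) * (p y * E1 + q y * E2)
    + 2 * c * D 1 φ y * (p y * E2 - q y * E1) - 4 * D 0 φ y * (D 0 p y * E1 + D 0 q y * E2)


/-- Weak convergence lemma. -/
lemma weak_lim (f : Euc 2 → ℝ) (g : ℝ → Euc 2 → ℝ) (C : ℝ) (hf : Continuous f)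
    (hf2 : Integrable (fun y => f y ^ 2))
    (hg : ∀ ε, Continuous (g ε)) (hg2 : ∀ᶠ ε in 𝓝[>] (0:ℝ), Integrable (fun y => g ε y ^ 2))
    (hC : ∀ᶠ ε in 𝓝[>] (0:ℝ), ∫ y, g ε y ^ 2 ≤ C)
    (hlim : ∀ y, Tendsto (fun ε => g ε y) (𝓝[>] (0:ℝ)) (𝓝 0)) :
    Tendsto (fun ε => ∫ y, f y * g ε y) (𝓝[>] (0:ℝ)) (𝓝 0) := by
  have hC0 : 0 ≤ C := by
    obtain ⟨ε, h⟩ := hC.exists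
    exact (integral_nonneg fun y => sq_nonneg _).trans h
  rw [Metric.tendsto_nhds]
  intro r hr
  set δ : ℝ := r / (C + 1) with hδ
  have hδ0 : 0 < δ := by positivity
  set h : ℝ → Euc 2 → ℝ := fun ε y => max (|f y * g ε y| - δ / 2 * g ε y ^ 2) 0 with hh
  have hcont : ∀ ε, Continuous (h ε) := fun ε => by
    have := hg ε
    rw [hh]; fun_prop
  have hbd : ∀ ε y, ‖h ε y‖ ≤ f y ^ 2 * (1 / (2 * δ)) := by
    intro ε y
    rw [Real.norm_of_nonneg (le_max_right _ _)]
    refine max_le ?_ (by positivity)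
    have h1 : |f y * g ε y| = |f y| * |g ε y| := abs_mul _ _
    rw [h1, ← sq_abs (f y), ← sq_abs (g ε y)]
    have : |f y| ^ 2 * (1 / (2 * δ)) - (|f y| * |g ε y| - δ / 2 * |g ε y| ^ 2)
        = (|f y| - δ * |g ε y|) ^ 2 / (2 * δ) := by field_simp; ring
    have h2 : 0 ≤ (|f y| - δ * |g ε y|) ^ 2 / (2 * δ) := by positivity
    linarith
  have hlim0 : Tendsto (fun ε => ∫ y, h ε y) (𝓝[>] (0:ℝ)) (𝓝 (∫ _y : Euc 2, (0:ℝ))) := by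
    refine tendsto_integral_filter_of_dominated_convergence _
      (Eventually.of_forall fun ε => (hcont ε).aestronglyMeasurable)
      (Eventually.of_forall fun ε => Eventually.of_forall fun y => hbd ε y)
      (hf2.mul_const _) (Eventually.of_forall fun y => ?_)
    have h1 : Tendsto (fun ε => max (|f y * g ε y| - δ / 2 * g ε y ^ 2) 0) (𝓝[>] (0:ℝ))
        (𝓝 (max (|f y * 0| - δ / 2 * 0 ^ 2) 0)) :=
      ((((hlim y).const_mul (f y)).abs).sub (((hlim y).pow 2).const_mul _)).max tendsto_const_nhds
    have e : max (|f y * 0| - δ / 2 * 0 ^ 2) 0 = 0 := by simp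
    rw [e] at h1
    exact h1
  rw [integral_zero, Metric.tendsto_nhds] at hlim0
  filter_upwards [hlim0 (r / 2) (by positivity), hg2, hC] with ε h1 h2 h3
  rw [Real.dist_eq, sub_zero] at h1 ⊢
  have hi : Integrable (h ε) := Integrable.mono' (hf2.mul_const (1 / (2 * δ)))
    (hcont ε).aestronglyMeasurable (Eventually.of_forall fun y => hbd ε y)
  calc |∫ y, f y * g ε y| ≤ ∫ y, |f y * g ε y| := abs_integral_le_integral_abs
    _ ≤ ∫ y, (h ε y + δ / 2 * g ε y ^ 2) := by
        refine integral_mono_of_nonneg (Eventually.of_forall fun y => abs_nonneg _)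
          (hi.add (h2.const_mul _)) (Eventually.of_forall fun y => ?_)
        have := le_max_left (|f y * g ε y| - δ / 2 * g ε y ^ 2) 0
        simp only [hh]; linarith
    _ = (∫ y, h ε y) + δ / 2 * ∫ y, g ε y ^ 2 := by
        rw [integral_add hi (h2.const_mul _), integral_const_mul]
    _ < r := by
        have h4 := (abs_lt.1 h1).2
        have h5 : δ / 2 * ∫ y, g ε y ^ 2 ≤ δ / 2 * C := by gcongr
        have h6 : δ / 2 * C ≤ r / 2 := by
          have : δ * (C + 1) = r := by rw [hδ]; field_simp
          nlinarith
        linarith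

/-- Existence of a smooth compactly supported function with a chain of derivatives. -/
lemma exists_chain (f₀ : ℝ → ℝ) (hf₀ : ContDiff ℝ (⊤ : ℕ∞) f₀) (hs : ∀ x, 2 < |x| → f₀ x = 0) :
    ∃ M : ℝ, 0 ≤ M ∧ (∀ i, ContDiff ℝ (⊤ : ℕ∞) (iteratedDeriv i f₀)) ∧
      (∀ i x, HasDerivAt (iteratedDeriv i f₀) (iteratedDeriv (i + 1) f₀ x) x) ∧
      (∀ i x, 2 < |x| → iteratedDeriv i f₀ x = 0) ∧
      (∀ i, i < 5 → ∀ x, |iteratedDeriv i f₀ x| ≤ M) := by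
  have hc : ∀ i, ContDiff ℝ (⊤ : ℕ∞) (iteratedDeriv i f₀) := by
    intro i
    rw [iteratedDeriv_eq_iterate]
    exact ContDiff.iterate_deriv i hf₀
  have hz : ∀ i x, 2 < |x| → iteratedDeriv i f₀ x = 0 := by
    intro i
    induction i with
    | zero => simpa using hs
    | succ i ih =>
      intro x hx
      rw [iteratedDeriv_succ]
      have : iteratedDeriv i f₀ =ᶠ[𝓝 x] fun _ => 0 := by
        filter_upwards [(isOpen_lt continuous_const continuous_abs).mem_nhds hx] with z hz
        exact ih z hz
      rw [this.deriv_eq]; simp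
  have hb : ∀ i, ∃ M, ∀ x, |iteratedDeriv i f₀ x| ≤ M := by
    intro i
    have hcs : HasCompactSupport (iteratedDeriv i f₀) :=
      HasCompactSupport.intro (isCompact_closedBall (0:ℝ) 2) fun x hx => hz i x (by
        simpa using hx)
    obtain ⟨M, hM⟩ := hcs.exists_bound_of_continuous (hc i).continuous
    exact ⟨M, hM⟩
  choose M hM using hb
  refine ⟨∑ i ∈ Finset.range 5, |M i|, by positivity, hc, ?_, hz, ?_⟩
  · intro i x
    rw [iteratedDeriv_succ]
    exact ((hc i).differentiable (by simp) x).hasDerivAt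
  · intro i hi x
    exact ((hM i x).trans (le_abs_self _)).trans
      (Finset.single_le_sum (f := fun i => |M i|) (fun _ _ => abs_nonneg _) (by simpa using hi))

/-- Product test functions. -/
def T (a0 a1 b0 b1 : ℝ) (f g : ℕ → ℝ → ℝ) (i j : ℕ) (y : Euc 2) : ℝ :=
  f i (a0 * y 0 + a1 * y 1) * g j (b0 * y 0 + b1 * y 1)

section T
variable {a0 a1 b0 b1 : ℝ} {f g : ℕ → ℝ → ℝ}

lemma T_smooth (hf : ∀ i, ContDiff ℝ (⊤ : ℕ∞) (f i)) (hg : ∀ i, ContDiff ℝ (⊤ : ℕ∞) (g i))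
    (i j : ℕ) : ContDiff ℝ (⊤ : ℕ∞) (T a0 a1 b0 b1 f g i j) := by
  have := hf i
  have := hg j
  unfold T
  fun_prop

lemma coord_fderiv (a0 a1 : ℝ) (y : Euc 2) :
    ∃ L : Euc 2 →L[ℝ] ℝ, HasFDerivAt (fun y : Euc 2 => a0 * y 0 + a1 * y 1) L y ∧
      L (basisVec 0) = a0 ∧ L (basisVec 1) = a1 := by
  refine ⟨a0 • EuclideanSpace.proj (0 : Fin 2) + a1 • EuclideanSpace.proj (1 : Fin 2), ?_, ?_, ?_⟩
  · exact (a0 • EuclideanSpace.proj (0 : Fin 2) + a1 • EuclideanSpace.proj (1 : Fin 2) :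
      Euc 2 →L[ℝ] ℝ).hasFDerivAt
  · simp [basisVec]
  · simp [basisVec]

lemma D_T (hf : ∀ i x, HasDerivAt (f i) (f (i + 1) x) x)
    (hg : ∀ i x, HasDerivAt (g i) (g (i + 1) x) x) (i j : ℕ) :
    D 0 (T a0 a1 b0 b1 f g i j) = (fun y => a0 * T a0 a1 b0 b1 f g (i + 1) j y
      + b0 * T a0 a1 b0 b1 f g i (j + 1) y) ∧
    D 1 (T a0 a1 b0 b1 f g i j) = (fun y => a1 * T a0 a1 b0 b1 f g (i + 1) j y
      + b1 * T a0 a1 b0 b1 f g i (j + 1) y) := by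
  have key : ∀ y, D 0 (T a0 a1 b0 b1 f g i j) y = a0 * T a0 a1 b0 b1 f g (i + 1) j y
      + b0 * T a0 a1 b0 b1 f g i (j + 1) y ∧ D 1 (T a0 a1 b0 b1 f g i j) y =
      a1 * T a0 a1 b0 b1 f g (i + 1) j y + b1 * T a0 a1 b0 b1 f g i (j + 1) y := by
    intro y
    obtain ⟨L, hL, l0, l1⟩ := coord_fderiv a0 a1 y
    obtain ⟨K, hK, k0, k1⟩ := coord_fderiv b0 b1 y
    have h1 := (hf i (a0 * y 0 + a1 * y 1)).comp_hasFDerivAt y hL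
    have h2 := (hg j (b0 * y 0 + b1 * y 1)).comp_hasFDerivAt y hK
    have h3 : HasFDerivAt (T a0 a1 b0 b1 f g i j) _ y := h1.mul h2
    unfold D
    rw [h3.fderiv]
    simp only [T, add_apply, smul_apply, smul_eq_mul,
      l0, l1, k0, k1, Function.comp]
    constructor <;> ring
  exact ⟨funext fun y => (key y).1, funext fun y => (key y).2⟩

lemma det_vol (hd : a0 * b1 - a1 * b0 ≠ 0) :
    volume {y : Euc 2 | |a0 * y 0 + a1 * y 1| ≤ 2 ∧ |b0 * y 0 + b1 * y 1| ≤ 2} ≤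
      ENNReal.ofReal |(a0 * b1 - a1 * b0)⁻¹| * volume (closedBall (0 : Euc 2) 3) := by
  set B := (EuclideanSpace.basisFun (Fin 2) ℝ).toBasis
  set A : Euc 2 →ₗ[ℝ] Euc 2 := Matrix.toLin B B !![a0, a1; b0, b1] with hA
  have hdet : LinearMap.det A = a0 * b1 - a1 * b0 := by
    rw [hA, LinearMap.det_toLin, Matrix.det_fin_two_of]
  rw [← hdet, ← Measure.addHaar_preimage_linearMap _ (by rwa [hdet])]
  refine measure_mono fun y hy => ?_
  have hA0 : A y 0 = a0 * y 0 + a1 * y 1 := by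
    simp [hA, B, Matrix.toLin_apply, Matrix.mulVec, dotProduct]
  have hA1 : A y 1 = b0 * y 0 + b1 * y 1 := by
    simp [hA, B, Matrix.toLin_apply, Matrix.mulVec, dotProduct]
  simp only [Set.mem_preimage, mem_closedBall, dist_zero_right]
  rw [EuclideanSpace.norm_eq, Real.sqrt_le_left (by norm_num)]
  simp only [Fin.sum_univ_two, hA0, hA1, Real.norm_eq_abs]
  obtain ⟨h1, h2⟩ := hy
  nlinarith [abs_nonneg (a0 * y 0 + a1 * y 1), abs_nonneg (b0 * y 0 + b1 * y 1)]

end T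

/-- The family of bump functions used. -/
lemma exists_fg : ∃ (f g : ℕ → ℝ → ℝ) (M : ℝ), 0 ≤ M ∧
    (∀ i, ContDiff ℝ (⊤ : ℕ∞) (f i)) ∧ (∀ i, ContDiff ℝ (⊤ : ℕ∞) (g i)) ∧
    (∀ i x, HasDerivAt (f i) (f (i + 1) x) x) ∧ (∀ i x, HasDerivAt (g i) (g (i + 1) x) x) ∧
    (∀ i x, 2 < |x| → f i x = 0) ∧ (∀ i x, 2 < |x| → g i x = 0) ∧
    (∀ i, i < 5 → ∀ x, |f i x| ≤ M) ∧ (∀ i, i < 5 → ∀ x, |g i x| ≤ M) ∧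
    f 2 0 = 1 ∧ g 0 0 = 1 := by
  let χ : ContDiffBump (0:ℝ) := ⟨1, 2, by norm_num, by norm_num⟩
  have hχ : ContDiff ℝ (⊤ : ℕ∞) χ := χ.contDiff
  have hz : ∀ x, 2 < |x| → χ x = 0 := fun x hx => by
    apply χ.zero_of_le_dist
    simpa [Real.dist_eq, χ] using hx.le
  obtain ⟨M1, a1, a2, a3, a4, a5⟩ := exists_chain (fun x => x ^ 2 / 2 * χ x) (by fun_prop)
    (fun x hx => by simp [hz x hx])
  obtain ⟨M2, b1, b2, b3, b4, b5⟩ := exists_chain χ hχ hz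
  refine ⟨fun i => iteratedDeriv i (fun x => x ^ 2 / 2 * χ x), fun i => iteratedDeriv i χ,
    max M1 M2, le_max_of_le_left a1, a2, b2, a3, b3, a4, b4,
    fun i hi x => (a5 i hi x).trans (le_max_left _ _),
    fun i hi x => (b5 i hi x).trans (le_max_right _ _), ?_, ?_⟩
  · have he : (fun x => x ^ 2 / 2 * χ x) =ᶠ[𝓝 0] fun x => x ^ 2 / 2 := by
      filter_upwards [χ.eventuallyEq_one] with x hx
      simp [hx]
    have h1 : deriv (fun x : ℝ => x ^ 2 / 2) = fun x => x := by
      ext x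
      simp
    show iteratedDeriv 2 _ 0 = 1
    rw [he.iteratedDeriv_eq, iteratedDeriv_succ, iteratedDeriv_one, h1]
    simp
  · show iteratedDeriv 0 χ 0 = 1
    rw [iteratedDeriv_zero]
    exact χ.one_of_mem_closedBall (by simp [χ])

set_option maxHeartbeats 8000000 in
lemma limit_id (c n1 n2 : ℝ) (hn : n1 ^ 2 + n2 ^ 2 = 1) (hc : c ^ 2 * n2 ^ 2 = 2)
    (p q : Euc 2 → ℝ) (hp : ContDiff ℝ 2 p) (hq : ContDiff ℝ 2 q)
    (e1 : ∀ y, D 0 (D 0 p) y + D 1 (D 1 p) y - c * D 1 q y + p y * (1 - p y ^ 2 - q y ^ 2) = 0)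
    (e2 : ∀ y, D 0 (D 0 q) y + D 1 (D 1 q) y + c * D 1 p y + q y * (1 - p y ^ 2 - q y ^ 2) = 0)
    (iη : Integrable (fun y => (1 - p y ^ 2 - q y ^ 2) ^ 2))
    (ip0 : Integrable (fun y => D 0 p y ^ 2)) (ip1 : Integrable (fun y => D 1 p y ^ 2))
    (iq0 : Integrable (fun y => D 0 q y ^ 2)) (iq1 : Integrable (fun y => D 1 q y ^ 2)) :
    ∫ y, (2 * (D 0 p y ^ 2 + D 1 p y ^ 2 + D 0 q y ^ 2 + D 1 q y ^ 2
              + (1 - p y ^ 2 - q y ^ 2) ^ 2)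
        - 2 * n1 ^ 2 * (D 1 p y ^ 2 + D 1 q y ^ 2 - D 0 p y ^ 2 - D 0 q y ^ 2)
        + 4 * (n1 * n2) * (D 0 p y * D 1 p y + D 0 q y * D 1 q y)
        - n1 ^ 2 * (1 - p y ^ 2 - q y ^ 2) ^ 2) = 0 := by
  obtain ⟨f, g, M, hM, fs, gs, fd, gd, fz, gz, fb, gb, f2, g0⟩ := exists_fg
  have cp0 : Continuous (D 0 p) := (D_smooth (m := 1) hp (by norm_num)).continuous
  have cp1 : Continuous (D 1 p) := (D_smooth (m := 1) hp (by norm_num)).continuous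
  have cq0 : Continuous (D 0 q) := (D_smooth (m := 1) hq (by norm_num)).continuous
  have cq1 : Continuous (D 1 q) := (D_smooth (m := 1) hq (by norm_num)).continuous
  have cp := hp.continuous
  have cq := hq.continuous
  set E : ℝ → ℕ → ℕ → Euc 2 → ℝ := fun ε =>
    T (ε * n1) (ε * n2) (-(ε ^ 3 * n2)) (ε ^ 3 * n1) f g with hE
  have Es : ∀ ε i j, ContDiff ℝ (⊤ : ℕ∞) (E ε i j) := fun ε i j => T_smooth fs gs i j
  have E4 : ∀ ε i j, ContDiff ℝ 4 (E ε i j) := fun ε i j => by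
    exact_mod_cast contDiff_infty.1 (Es ε i j) 4
  have Ec : ∀ ε i j, Continuous (E ε i j) := fun ε i j => (Es ε i j).continuous
  have Ed : ∀ ε i j, Differentiable ℝ (E ε i j) := fun ε i j =>
    (Es ε i j).differentiable (by simp)
  have Eb : ∀ ε i j y, i < 5 → j < 5 → |E ε i j y| ≤ M ^ 2 := by
    intro ε i j y hi hj
    simp only [hE, T, abs_mul, sq]
    exact mul_le_mul (fb i hi _) (gb j hj _) (abs_nonneg _) hM
  have El : ∀ i j y, Tendsto (fun ε => E ε i j y) (𝓝[>] (0:ℝ)) (𝓝 (f i 0 * g j 0)) := by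
    intro i j y
    have : Continuous fun ε => E ε i j y := by
      have := (fs i).continuous
      have := (gs j).continuous
      simp only [hE, T]; fun_prop
    have h := (this.tendsto 0).mono_left (nhdsWithin_le_nhds (s := Set.Ioi 0))
    simpa [hE, T] using h
  have hε0 : Tendsto (fun ε : ℝ => ε) (𝓝[>] (0:ℝ)) (𝓝 0) := nhdsWithin_le_nhds
  have hε1 : ∀ᶠ ε : ℝ in 𝓝[>] (0:ℝ), ε < 1 := hε0.eventually (gt_mem_nhds one_pos)
  have hεp : ∀ᶠ ε : ℝ in 𝓝[>] (0:ℝ), 0 < ε := self_mem_nhdsWithin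
  -- the support strip
  set S : ℝ → Set (Euc 2) := fun ε => {y | |ε * n1 * y 0 + ε * n2 * y 1| ≤ 2 ∧
    |-(ε ^ 3 * n2) * y 0 + ε ^ 3 * n1 * y 1| ≤ 2} with hS
  have Ez : ∀ ε i j y, y ∉ S ε → E ε i j y = 0 := by
    intro ε i j y hy
    simp only [hS, Set.mem_ofPred_eq, not_and_or, not_le] at hy
    simp only [hE, T]
    rcases hy with h | h
    · rw [fz _ _ h, zero_mul]
    · rw [gz _ _ h, mul_zero]
  set V : ℝ := (volume (closedBall (0 : Euc 2) 3)).toReal with hV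
  have hVfin : volume (closedBall (0 : Euc 2) 3) ≠ ⊤ := measure_closedBall_lt_top.ne
  have hdet : ∀ ε : ℝ, (ε * n1) * (ε ^ 3 * n1) - (ε * n2) * (-(ε ^ 3 * n2)) = ε ^ 4 := by
    intro ε
    linear_combination ε ^ 4 * hn
  have Svol : ∀ ε : ℝ, 0 < ε → volume (S ε) ≤ ENNReal.ofReal ((ε ^ 4)⁻¹ * V) := by
    intro ε hε
    have h := det_vol (a0 := ε * n1) (a1 := ε * n2) (b0 := -(ε ^ 3 * n2)) (b1 := ε ^ 3 * n1)
      (by rw [hdet]; positivity)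
    rw [hdet, abs_of_nonneg (by positivity)] at h
    rw [ENNReal.ofReal_mul (by positivity), hV, ENNReal.ofReal_toReal hVfin]
    exact h
  have Smeas : ∀ ε, MeasurableSet (S ε) := by
    intro ε
    apply IsClosed.measurableSet
    exact (isClosed_le (f := fun y : Euc 2 => |ε * n1 * y 0 + ε * n2 * y 1|) (g := fun _ => 2)
      (by fun_prop) continuous_const).inter
      (isClosed_le (f := fun y : Euc 2 => |-(ε ^ 3 * n2) * y 0 + ε ^ 3 * n1 * y 1|)
        (g := fun _ => 2) (by fun_prop) continuous_const)
  have Ecs : ∀ ε, 0 < ε → HasCompactSupport (E ε 0 0) := by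
    intro ε hε
    refine HasCompactSupport.intro (isCompact_closedBall (0 : Euc 2) (4 / ε + 4 / ε ^ 3))
      fun y hy => Ez ε 0 0 y fun hyS => hy ?_
    obtain ⟨h1, h2⟩ := hyS
    have g1 : |n1 * y 0 + n2 * y 1| ≤ 2 / ε := by
      rw [le_div_iff₀ hε, mul_comm]
      refine le_trans (le_of_eq ?_) h1
      have e : ε * n1 * y 0 + ε * n2 * y 1 = ε * (n1 * y 0 + n2 * y 1) := by ring
      rw [e, abs_mul, abs_of_pos hε]
    have g2 : |-n2 * y 0 + n1 * y 1| ≤ 2 / ε ^ 3 := by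
      have h3 : 0 < ε ^ 3 := by positivity
      rw [le_div_iff₀ h3, mul_comm]
      refine le_trans (le_of_eq ?_) h2
      have e : -(ε ^ 3 * n2) * y 0 + ε ^ 3 * n1 * y 1 = ε ^ 3 * (-n2 * y 0 + n1 * y 1) := by ring
      rw [e, abs_mul, abs_of_pos h3]
    simp only [mem_closedBall, dist_zero_right]
    rw [EuclideanSpace.norm_eq, Real.sqrt_le_left (by positivity)]
    simp only [Fin.sum_univ_two, Real.norm_eq_abs, sq_abs]
    have h4 : y 0 ^ 2 + y 1 ^ 2 = (n1 * y 0 + n2 * y 1) ^ 2 + (-n2 * y 0 + n1 * y 1) ^ 2 := by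
      linear_combination (-(y 0 ^ 2 + y 1 ^ 2)) * hn
    rw [h4, ← sq_abs (n1 * y 0 + n2 * y 1), ← sq_abs (-n2 * y 0 + n1 * y 1)]
    have g3 : (0:ℝ) < 1 / ε := by positivity
    have g4 : (0:ℝ) < 1 / ε ^ 3 := by positivity
    have q1 : 2 / ε = 2 * (1 / ε) := by ring
    have q2 : 2 / ε ^ 3 = 2 * (1 / ε ^ 3) := by ring
    have q3 : 4 / ε = 4 * (1 / ε) := by ring
    have q4 : 4 / ε ^ 3 = 4 * (1 / ε ^ 3) := by ring
    rw [q1] at g1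
    rw [q2] at g2
    rw [q3, q4]
    nlinarith [abs_nonneg (n1 * y 0 + n2 * y 1), abs_nonneg (-n2 * y 0 + n1 * y 1),
      mul_pos g3 g4]
  -- rescaled derivative quantities
  set R : ℝ → Euc 2 → ℝ := fun ε y => ε ^ 2 * (E ε 4 0 y + 2 * ε ^ 4 * E ε 2 2 y
    + ε ^ 8 * E ε 0 4 y - 2 * ε ^ 2 * E ε 0 2 y + 2 * c ^ 2 * (n1 * n2) * E ε 1 1 y
    + c ^ 2 * n1 ^ 2 * ε ^ 2 * E ε 0 2 y) with hR
  set l : ℝ → Euc 2 → ℝ := fun ε y => E ε 2 0 y + ε ^ 4 * E ε 0 2 y with hl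
  set h0 : ℝ → Euc 2 → ℝ := fun ε y => n1 ^ 2 * E ε 2 0 y - 2 * ε ^ 2 * (n1 * n2) * E ε 1 1 y
    + ε ^ 4 * n2 ^ 2 * E ε 0 2 y with hh0
  set h1 : ℝ → Euc 2 → ℝ := fun ε y => n1 * n2 * E ε 2 0 y
    + ε ^ 2 * (n1 ^ 2 - n2 ^ 2) * E ε 1 1 y - ε ^ 4 * (n1 * n2) * E ε 0 2 y with hh1
  set Z : ℝ → Euc 2 → ℝ := fun ε y => (2 * (D 0 p y ^ 2 + D 1 p y ^ 2 + D 0 q y ^ 2 + D 1 q y ^ 2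
              + (1 - p y ^ 2 - q y ^ 2) ^ 2) * l ε y
        - 2 * h0 ε y * (D 1 p y ^ 2 + D 1 q y ^ 2 - D 0 p y ^ 2 - D 0 q y ^ 2)
        + 4 * h1 ε y * (D 0 p y * D 1 p y + D 0 q y * D 1 q y)
        - h0 ε y * (1 - p y ^ 2 - q y ^ 2) ^ 2) with hZ
  have id1 : ∀ ε, 0 < ε → ∫ y, ((1 - p y ^ 2 - q y ^ 2) * R ε y + Z ε y) = 0 := by
    intro ε hε
    have hm := main_id c p q (E ε 0 0) hp hq (E4 ε 0 0)
      (Ecs ε hε) e1 e2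
    have DT0 : ∀ i j, D 0 (E ε i j) = fun y => ε * n1 * E ε (i + 1) j y
      + -(ε ^ 3 * n2) * E ε i (j + 1) y := fun i j => (D_T fd gd i j).1
    have DT1 : ∀ i j, D 1 (E ε i j) = fun y => ε * n2 * E ε (i + 1) j y
      + ε ^ 3 * n1 * E ε i (j + 1) y := fun i j => (D_T fd gd i j).2
    have dl : ∀ (k : Fin 2) (a b : ℝ) (i j i' j' : ℕ),
        D k (fun y => a * E ε i j y + b * E ε i' j' y) =
          fun y => a * D k (E ε i j) y + b * D k (E ε i' j') y := by
      intro k a b i j i' j'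
      ext y
      rw [D_add ((Ed ε i j).const_mul a) ((Ed ε i' j').const_mul b), D_cmul (Ed _ _ _),
        D_cmul (Ed _ _ _)]
    have dl3 : ∀ (k : Fin 2) (a b d : ℝ) (i j i' j' i'' j'' : ℕ),
        D k (fun y => a * E ε i j y + b * E ε i' j' y + d * E ε i'' j'' y) =
          fun y => a * D k (E ε i j) y + b * D k (E ε i' j') y + d * D k (E ε i'' j'') y := by
      intro k a b d i j i' j' i'' j''
      ext y
      rw [D_add (((Ed ε i j).const_mul a).fun_add ((Ed ε i' j').const_mul b))
        ((Ed ε i'' j'').const_mul d),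
        D_add ((Ed ε i j).const_mul a) ((Ed ε i' j').const_mul b), D_cmul (Ed _ _ _),
        D_cmul (Ed _ _ _), D_cmul (Ed _ _ _)]
    have D00 : ∀ i j, D 0 (D 0 (E ε i j)) = fun y => ε ^ 2 * n1 ^ 2 * E ε (i + 2) j y
        + -(2 * ε ^ 4 * (n1 * n2)) * E ε (i + 1) (j + 1) y + ε ^ 6 * n2 ^ 2 * E ε i (j + 2) y := by
      intro i j
      rw [DT0, dl]; ext y; rw [DT0, DT0]; ring
    have D11 : ∀ i j, D 1 (D 1 (E ε i j)) = fun y => ε ^ 2 * n2 ^ 2 * E ε (i + 2) j y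
        + (2 * ε ^ 4 * (n1 * n2)) * E ε (i + 1) (j + 1) y + ε ^ 6 * n1 ^ 2 * E ε i (j + 2) y := by
      intro i j
      rw [DT1, dl]; ext y; rw [DT1, DT1]; ring
    have D10 : ∀ i j, D 1 (D 0 (E ε i j)) = fun y => ε ^ 2 * (n1 * n2) * E ε (i + 2) j y
        + (ε ^ 4 * (n1 ^ 2 - n2 ^ 2)) * E ε (i + 1) (j + 1) y
        + -(ε ^ 6 * (n1 * n2)) * E ε i (j + 2) y := by
      intro i j
      rw [DT0, dl]; ext y; rw [DT1, DT1]; ring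
    have DD : ∀ (k : Fin 2) (a b d : ℝ) (i j i' j' i'' j'' : ℕ),
        D k (D k (fun y => a * E ε i j y + b * E ε i' j' y + d * E ε i'' j'' y)) =
          fun y => a * D k (D k (E ε i j)) y + b * D k (D k (E ε i' j')) y
            + d * D k (D k (E ε i'' j'')) y := by
      intro k a b d i j i' j' i'' j''
      have dE : ∀ i j, Differentiable ℝ (D k (E ε i j)) := fun i j =>
        (D_smooth (m := 1) (E4 ε i j) (by norm_num)).differentiable (by norm_num)
      rw [dl3]
      ext y
      rw [D_add (((dE i j).const_mul a).fun_add ((dE i' j').const_mul b))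
        ((dE i'' j'').const_mul d),
        D_add ((dE i j).const_mul a) ((dE i' j').const_mul b), D_cmul (dE _ _),
        D_cmul (dE _ _), D_cmul (dE _ _)]
    have hpt : ∀ y, ((1 - p y ^ 2 - q y ^ 2) * R ε y + Z ε y) = (ε ^ 2)⁻¹ *
      ((1 - p y ^ 2 - q y ^ 2) *
        ((D 0 (D 0 (D 0 (D 0 (E ε 0 0)))) y + D 1 (D 1 (D 0 (D 0 (E ε 0 0)))) y
          + D 0 (D 0 (D 1 (D 1 (E ε 0 0)))) y + D 1 (D 1 (D 1 (D 1 (E ε 0 0)))) y)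
          - 2 * (D 0 (D 0 (E ε 0 0)) y + D 1 (D 1 (E ε 0 0)) y) + c ^ 2 * D 1 (D 1 (E ε 0 0)) y)
      + (2 * (D 0 p y ^ 2 + D 1 p y ^ 2 + D 0 q y ^ 2 + D 1 q y ^ 2
              + (1 - p y ^ 2 - q y ^ 2) ^ 2) * (D 0 (D 0 (E ε 0 0)) y + D 1 (D 1 (E ε 0 0)) y)
        - 2 * D 0 (D 0 (E ε 0 0)) y * (D 1 p y ^ 2 + D 1 q y ^ 2 - D 0 p y ^ 2 - D 0 q y ^ 2)
        + 4 * D 1 (D 0 (E ε 0 0)) y * (D 0 p y * D 1 p y + D 0 q y * D 1 q y)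
        - D 0 (D 0 (E ε 0 0)) y * (1 - p y ^ 2 - q y ^ 2) ^ 2)) := by
      intro y
      have A0 : D 0 (D 0 (E ε 0 0)) y = ε ^ 2 * h0 ε y := by
        rw [D00]; simp only [hh0]; ring
      have A1 : D 1 (D 0 (E ε 0 0)) y = ε ^ 2 * h1 ε y := by
        rw [D10]; simp only [hh1]; ring
      have A2 : D 0 (D 0 (E ε 0 0)) y + D 1 (D 1 (E ε 0 0)) y = ε ^ 2 * l ε y := by
        rw [D00, D11]; simp only [hl]
        linear_combination (ε ^ 2 * E ε 2 0 y + ε ^ 6 * E ε 0 2 y) * hn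
      have A3 : (D 0 (D 0 (D 0 (D 0 (E ε 0 0)))) y + D 1 (D 1 (D 0 (D 0 (E ε 0 0)))) y
          + D 0 (D 0 (D 1 (D 1 (E ε 0 0)))) y + D 1 (D 1 (D 1 (D 1 (E ε 0 0)))) y)
          = ε ^ 4 * (E ε 4 0 y + 2 * ε ^ 4 * E ε 2 2 y + ε ^ 8 * E ε 0 4 y) := by
        rw [D00 0 0, D11 0 0, DD, DD, DD, DD]
        simp only [D00, D11]
        norm_num
        linear_combination (n1 ^ 2 + n2 ^ 2 + 1) *
          (ε ^ 4 * (E ε 4 0 y + 2 * ε ^ 4 * E ε 2 2 y + ε ^ 8 * E ε 0 4 y)) * hn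
      have A4 : - 2 * (ε ^ 2 * l ε y) + c ^ 2 * D 1 (D 1 (E ε 0 0)) y
          = ε ^ 4 * (- 2 * ε ^ 2 * E ε 0 2 y + 2 * c ^ 2 * (n1 * n2) * E ε 1 1 y
            + c ^ 2 * n1 ^ 2 * ε ^ 2 * E ε 0 2 y) := by
        rw [D11]; simp only [hl]
        linear_combination (ε ^ 2 * E ε 2 0 y) * hc
      rw [A3, A2, A1, A0]
      rw [eq_inv_mul_iff_mul_eq₀ (by positivity)]
      simp only [hR, hZ]
      linear_combination (-(1 - p y ^ 2 - q y ^ 2)) * A4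
    simp_rw [hpt]
    rw [integral_const_mul, hm, mul_zero]
  have Rc : ∀ ε, Continuous (R ε) := by
    intro ε
    have := Ec ε 4 0; have := Ec ε 2 2; have := Ec ε 0 4; have := Ec ε 0 2; have := Ec ε 1 1
    simp only [hR]; fun_prop
  set K : ℝ := M ^ 2 * (1 + 2 + 1 + 2 + 2 * c ^ 2 + c ^ 2) with hK
  have hK0 : 0 ≤ K := by positivity
  have n1le : n1 ^ 2 ≤ 1 := by nlinarith [sq_nonneg n2]
  have n2le : n2 ^ 2 ≤ 1 := by nlinarith [sq_nonneg n1]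
  have n12le : |n1 * n2| ≤ 1 := by
    rw [abs_le]; constructor <;> nlinarith [sq_nonneg (n1 + n2), sq_nonneg (n1 - n2)]
  have mulb : ∀ {a x A : ℝ}, |a| ≤ A → |x| ≤ M ^ 2 → |a * x| ≤ A * M ^ 2 := by
    intro a x A ha hx
    rw [abs_mul]
    exact mul_le_mul ha hx (abs_nonneg _) ((abs_nonneg _).trans ha)
  have powb : ∀ {ε : ℝ} (k : ℕ), 0 < ε → ε < 1 → |ε ^ k| ≤ 1 := by
    intro ε k a b
    rw [abs_of_pos (by positivity)]
    exact pow_le_one₀ a.le b.le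
  have Rb : ∀ ε, 0 < ε → ε < 1 → ∀ y, |R ε y| ≤ ε ^ 2 * K := by
    intro ε hε hε' y
    simp only [hR]
    rw [abs_mul, abs_of_nonneg (by positivity : 0 ≤ ε ^ 2)]
    refine mul_le_mul_of_nonneg_left ?_ (by positivity)
    have b1 := Eb ε 4 0 y (by norm_num) (by norm_num)
    have b2 := mulb (a := 2 * ε ^ 4) (A := 2) (by
      have h4 : ε ^ 4 ≤ 1 := pow_le_one₀ hε.le hε'.le
      rw [abs_of_nonneg (by positivity)]; linarith)
      (Eb ε 2 2 y (by norm_num) (by norm_num))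
    have b3 := mulb (powb 8 hε hε') (Eb ε 0 4 y (by norm_num) (by norm_num))
    have b4 := mulb (a := 2 * ε ^ 2) (A := 2) (by
      have h4 : ε ^ 2 ≤ 1 := pow_le_one₀ hε.le hε'.le
      rw [abs_of_nonneg (by positivity)]; linarith)
      (Eb ε 0 2 y (by norm_num) (by norm_num))
    have b5 := mulb (a := 2 * c ^ 2 * (n1 * n2)) (A := 2 * c ^ 2) (by
      rw [abs_mul, abs_of_nonneg (by positivity : 0 ≤ 2 * c ^ 2)]
      nlinarith [sq_nonneg c]) (Eb ε 1 1 y (by norm_num) (by norm_num))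
    have b6 := mulb (a := c ^ 2 * n1 ^ 2 * ε ^ 2) (A := c ^ 2) (by
      rw [abs_of_nonneg (by positivity)]
      have : ε ^ 2 ≤ 1 := pow_le_one₀ hε.le hε'.le
      have h : n1 ^ 2 * ε ^ 2 ≤ 1 := mul_le_one₀ n1le (by positivity) this
      nlinarith [sq_nonneg c]) (Eb ε 0 2 y (by norm_num) (by norm_num))
    rw [abs_le] at *
    constructor <;> simp only [hK] <;> linarith [b1.1, b1.2, b2.1, b2.2, b3.1, b3.2, b4.1, b4.2,
      b5.1, b5.2, b6.1, b6.2]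
  have Rz : ∀ ε y, y ∉ S ε → R ε y = 0 := by
    intro ε y hy
    simp only [hR, Ez ε _ _ y hy]; ring
  have Rle : ∀ ε, 0 < ε → ε < 1 → ∀ y, R ε y ^ 2 ≤ (S ε).indicator (fun _ => ε ^ 4 * K ^ 2) y := by
    intro ε hε hε' y
    by_cases hy : y ∈ S ε
    · rw [Set.indicator_of_mem hy, ← sq_abs]
      calc |R ε y| ^ 2 ≤ (ε ^ 2 * K) ^ 2 := by gcongr; exact Rb ε hε hε' y
        _ = _ := by ring
    · rw [Set.indicator_of_notMem hy, Rz ε y hy]; norm_num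
  have Sfin : ∀ ε, 0 < ε → volume (S ε) < ⊤ := fun ε hε =>
    (Svol ε hε).trans_lt ENNReal.ofReal_lt_top
  have Iind : ∀ ε, 0 < ε → Integrable ((S ε).indicator (fun _ => ε ^ 4 * K ^ 2)) := by
    intro ε hε
    rw [integrable_indicator_iff (Smeas ε)]
    exact integrableOn_const (Sfin ε hε).ne
  have Rint : ∀ ε, 0 < ε → ε < 1 → Integrable (fun y => R ε y ^ 2) := by
    intro ε hε hε'
    refine (Iind ε hε).mono' ((Rc ε).pow 2).aestronglyMeasurable (Eventually.of_forall fun y => ?_)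
    rw [Real.norm_of_nonneg (sq_nonneg _)]
    exact Rle ε hε hε' y
  have Rint2 : ∀ ε, 0 < ε → ε < 1 → ∫ y, R ε y ^ 2 ≤ K ^ 2 * V := by
    intro ε hε hε'
    refine (integral_mono (Rint ε hε hε') (Iind ε hε) (Rle ε hε hε')).trans ?_
    rw [integral_indicator (Smeas ε), setIntegral_const, smul_eq_mul]
    have : volume.real (S ε) ≤ (ε ^ 4)⁻¹ * V :=
      ENNReal.toReal_le_of_le_ofReal (by positivity) (Svol ε hε)
    calc volume.real (S ε) * (ε ^ 4 * K ^ 2) ≤ ((ε ^ 4)⁻¹ * V) * (ε ^ 4 * K ^ 2) := by gcongr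
      _ = K ^ 2 * V := by field_simp
  have cη : Continuous (fun y => 1 - p y ^ 2 - q y ^ 2) := by fun_prop
  have lim1 := weak_lim (fun y => 1 - p y ^ 2 - q y ^ 2) R (K ^ 2 * V) cη iη Rc
    (by filter_upwards [hε1, hεp] with ε a b using Rint ε b a)
    (by filter_upwards [hε1, hεp] with ε a b using Rint2 ε b a)
    (by
      intro y
      refine squeeze_zero_norm' (a := fun ε => ε ^ 2 * K) ?_ ?_
      · filter_upwards [hε1, hεp] with ε a b using Rb ε b a y
      · simpa using (hε0.pow 2).mul_const K)
  -- the dominated part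
  have lc : ∀ ε, Continuous (l ε) := by
    intro ε
    have := Ec ε 2 0; have := Ec ε 0 2
    simp only [hl]; fun_prop
  have h0c : ∀ ε, Continuous (h0 ε) := by
    intro ε
    have := Ec ε 2 0; have := Ec ε 0 2; have := Ec ε 1 1
    simp only [hh0]; fun_prop
  have h1c : ∀ ε, Continuous (h1 ε) := by
    intro ε
    have := Ec ε 2 0; have := Ec ε 0 2; have := Ec ε 1 1
    simp only [hh1]; fun_prop
  set N : ℝ := 4 * M ^ 2 with hN
  have hN0 : 0 ≤ N := by positivity
  have bnds : ∀ ε, 0 < ε → ε < 1 → ∀ y, |l ε y| ≤ N ∧ |h0 ε y| ≤ N ∧ |h1 ε y| ≤ N := by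
    intro ε hε hε' y
    have c1 := Eb ε 2 0 y (by norm_num) (by norm_num)
    have c2 := Eb ε 0 2 y (by norm_num) (by norm_num)
    have c3 := Eb ε 1 1 y (by norm_num) (by norm_num)
    have p4 : ε ^ 4 ≤ 1 := pow_le_one₀ hε.le hε'.le
    have p2 : ε ^ 2 ≤ 1 := pow_le_one₀ hε.le hε'.le
    have d1 := mulb (powb 4 hε hε') c2
    have d2 := mulb (a := n1 ^ 2) (A := 1) (by rwa [abs_of_nonneg (by positivity)]) c1
    have d3 := mulb (a := 2 * ε ^ 2 * (n1 * n2)) (A := 2) (by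
      rw [abs_mul, abs_of_nonneg (by positivity : 0 ≤ 2 * ε ^ 2)]
      nlinarith [abs_nonneg (n1 * n2)]) c3
    have d4 := mulb (a := ε ^ 4 * n2 ^ 2) (A := 1) (by
      rw [abs_of_nonneg (by positivity)]
      exact mul_le_one₀ p4 (by positivity) n2le) c2
    have d5 := mulb n12le c1
    have d6 := mulb (a := ε ^ 2 * (n1 ^ 2 - n2 ^ 2)) (A := 1) (by
      rw [abs_mul, abs_of_nonneg (by positivity : 0 ≤ ε ^ 2)]
      refine mul_le_one₀ p2 (abs_nonneg _) ?_
      rw [abs_le]; constructor <;> nlinarith [sq_nonneg n1, sq_nonneg n2]) c3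
    have d7 := mulb (a := ε ^ 4 * (n1 * n2)) (A := 1) (by
      rw [abs_mul, abs_of_nonneg (by positivity : 0 ≤ ε ^ 4)]
      exact mul_le_one₀ p4 (abs_nonneg _) n12le) c2
    have hM2 : 0 ≤ M ^ 2 := by positivity
    rw [abs_le] at c1 c2 c3 d1 d2 d3 d4 d5 d6 d7
    obtain ⟨c1l, c1r⟩ := c1
    obtain ⟨d1l, d1r⟩ := d1
    obtain ⟨d2l, d2r⟩ := d2
    obtain ⟨d3l, d3r⟩ := d3
    obtain ⟨d4l, d4r⟩ := d4
    obtain ⟨d5l, d5r⟩ := d5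
    obtain ⟨d6l, d6r⟩ := d6
    obtain ⟨d7l, d7r⟩ := d7
    refine ⟨?_, ?_, ?_⟩ <;> rw [abs_le] <;> constructor <;> simp only [hl, hh0, hh1, hN] <;>
      linarith
  set G : Euc 2 → ℝ := fun y => D 0 p y ^ 2 + D 1 p y ^ 2 + D 0 q y ^ 2 + D 1 q y ^ 2
    + (1 - p y ^ 2 - q y ^ 2) ^ 2 with hG
  have iG : Integrable G := (((ip0.add ip1).add iq0).add iq1).add iη
  have Zc : ∀ ε, Continuous (Z ε) := by
    intro ε
    have := lc ε; have := h0c ε; have := h1c ε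
    simp only [hZ]; fun_prop
  have Zb : ∀ ε, 0 < ε → ε < 1 → ∀ y, ‖Z ε y‖ ≤ 7 * N * G y := by
    intro ε hε hε' y
    obtain ⟨k1, k2, k3⟩ := bnds ε hε hε' y
    have gen : ∀ {x X B : ℝ}, |x| ≤ N → |X| ≤ B → |x * X| ≤ N * B := by
      intro x X B hx hX
      rw [abs_mul]; exact mul_le_mul hx hX (abs_nonneg _) hN0
    have t1 := gen k1 (X := G y) (B := G y) (abs_of_nonneg (by simp only [hG]; positivity)).le
    have t2 := gen k2 (X := D 1 p y ^ 2 + D 1 q y ^ 2 - D 0 p y ^ 2 - D 0 q y ^ 2) (B := G y) (by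
      simp only [hG]; rw [abs_le]
      constructor <;> nlinarith [sq_nonneg (D 0 p y), sq_nonneg (D 1 p y), sq_nonneg (D 0 q y),
        sq_nonneg (D 1 q y), sq_nonneg (1 - p y ^ 2 - q y ^ 2)])
    have t3 := gen k3 (X := D 0 p y * D 1 p y + D 0 q y * D 1 q y) (B := G y / 2) (by
      simp only [hG]; rw [abs_le]
      constructor <;> nlinarith [sq_nonneg (D 0 p y + D 1 p y), sq_nonneg (D 0 p y - D 1 p y),
        sq_nonneg (D 0 q y + D 1 q y), sq_nonneg (D 0 q y - D 1 q y),
        sq_nonneg (1 - p y ^ 2 - q y ^ 2)])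
    have t4 := gen k2 (X := (1 - p y ^ 2 - q y ^ 2) ^ 2) (B := G y) (by
      rw [abs_of_nonneg (sq_nonneg _)]
      simp only [hG]
      nlinarith [sq_nonneg (D 0 p y), sq_nonneg (D 1 p y), sq_nonneg (D 0 q y),
        sq_nonneg (D 1 q y)])
    rw [Real.norm_eq_abs]
    have e : Z ε y = 2 * (l ε y * G y)
        - 2 * (h0 ε y * (D 1 p y ^ 2 + D 1 q y ^ 2 - D 0 p y ^ 2 - D 0 q y ^ 2))
        + 4 * (h1 ε y * (D 0 p y * D 1 p y + D 0 q y * D 1 q y))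
        - h0 ε y * (1 - p y ^ 2 - q y ^ 2) ^ 2 := by
      simp only [hZ, hG]; ring
    rw [e]
    rw [abs_le] at t1 t2 t3 t4 ⊢
    obtain ⟨t1l, t1r⟩ := t1
    obtain ⟨t2l, t2r⟩ := t2
    obtain ⟨t3l, t3r⟩ := t3
    obtain ⟨t4l, t4r⟩ := t4
    constructor <;> linarith
  have Zint : ∀ ε, 0 < ε → ε < 1 → Integrable (Z ε) := fun ε hε hε' =>
    (iG.const_mul (7 * N)).mono' (Zc ε).aestronglyMeasurable
      (Eventually.of_forall (Zb ε hε hε'))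
  have lim2 : Tendsto (fun ε => ∫ y, Z ε y) (𝓝[>] (0:ℝ)) (𝓝 (∫ y, (2 * (D 0 p y ^ 2 + D 1 p y ^ 2
              + D 0 q y ^ 2 + D 1 q y ^ 2 + (1 - p y ^ 2 - q y ^ 2) ^ 2)
        - 2 * n1 ^ 2 * (D 1 p y ^ 2 + D 1 q y ^ 2 - D 0 p y ^ 2 - D 0 q y ^ 2)
        + 4 * (n1 * n2) * (D 0 p y * D 1 p y + D 0 q y * D 1 q y)
        - n1 ^ 2 * (1 - p y ^ 2 - q y ^ 2) ^ 2))) := by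
    refine tendsto_integral_filter_of_dominated_convergence (fun y => 7 * N * G y)
      (Eventually.of_forall fun ε => (Zc ε).aestronglyMeasurable)
      (by filter_upwards [hε1, hεp] with ε a b using Eventually.of_forall (Zb ε b a))
      (iG.const_mul _) (Eventually.of_forall fun y => ?_)
    have L20 := El 2 0 y
    rw [f2, g0, mul_one] at L20
    have L11 := El 1 1 y
    have L02 := El 0 2 y
    have tl : Tendsto (fun ε => l ε y) (𝓝[>] (0:ℝ)) (𝓝 1) := by
      have := L20.add ((hε0.pow 4).mul L02)
      simpa [hl] using this
    have t0 : Tendsto (fun ε => h0 ε y) (𝓝[>] (0:ℝ)) (𝓝 (n1 ^ 2)) := by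
      have := ((L20.const_mul (n1 ^ 2)).sub
        ((((hε0.pow 2).const_mul 2).mul_const (n1 * n2)).mul L11)).add
        (((hε0.pow 4).mul_const (n2 ^ 2)).mul L02)
      simpa [hh0] using this
    have t1 : Tendsto (fun ε => h1 ε y) (𝓝[>] (0:ℝ)) (𝓝 (n1 * n2)) := by
      have := ((L20.const_mul (n1 * n2)).add
        (((hε0.pow 2).mul_const (n1 ^ 2 - n2 ^ 2)).mul L11)).sub
        (((hε0.pow 4).mul_const (n1 * n2)).mul L02)
      simpa [hh1] using this
    have := (((tl.const_mul (2 * (D 0 p y ^ 2 + D 1 p y ^ 2 + D 0 q y ^ 2 + D 1 q y ^ 2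
      + (1 - p y ^ 2 - q y ^ 2) ^ 2))).sub ((t0.const_mul 2).mul_const
      (D 1 p y ^ 2 + D 1 q y ^ 2 - D 0 p y ^ 2 - D 0 q y ^ 2))).add ((t1.const_mul 4).mul_const
      (D 0 p y * D 1 p y + D 0 q y * D 1 q y))).sub (t0.mul_const ((1 - p y ^ 2 - q y ^ 2) ^ 2))
    rw [mul_one] at this
    exact this
  have fin : (fun ε => ∫ y, Z ε y) =ᶠ[𝓝[>] (0:ℝ)]
      fun ε => -∫ y, (1 - p y ^ 2 - q y ^ 2) * R ε y := by
    filter_upwards [hε1, hεp] with ε a b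
    have hi : Integrable (fun y => (1 - p y ^ 2 - q y ^ 2) * R ε y) := by
      refine (iη.add (Rint ε b a)).mono' ((cη.mul (Rc ε)).aestronglyMeasurable)
        (Eventually.of_forall fun y => ?_)
      rw [Real.norm_eq_abs, abs_le]
      simp only [Pi.add_apply]
      constructor <;> nlinarith [sq_nonneg ((1 - p y ^ 2 - q y ^ 2) + R ε y),
        sq_nonneg ((1 - p y ^ 2 - q y ^ 2) - R ε y), sq_nonneg (R ε y),
        sq_nonneg (1 - p y ^ 2 - q y ^ 2)]
    have := id1 ε b
    rw [integral_add hi (Zint ε b a)] at this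
    linarith
  have lim3 := lim2.congr' fin
  have lim4 := lim1.neg
  rw [neg_zero] at lim4
  exact tendsto_nhds_unique lim3 lim4

set_option maxHeartbeats 2000000 in
/-- Conclusion in terms of real and imaginary parts. -/
lemma rigid (c : ℝ) (hc : Real.sqrt 2 ≤ c)
    (p q : Euc 2 → ℝ) (hp : ContDiff ℝ 2 p) (hq : ContDiff ℝ 2 q)
    (e1 : ∀ y, D 0 (D 0 p) y + D 1 (D 1 p) y - c * D 1 q y + p y * (1 - p y ^ 2 - q y ^ 2) = 0)
    (e2 : ∀ y, D 0 (D 0 q) y + D 1 (D 1 q) y + c * D 1 p y + q y * (1 - p y ^ 2 - q y ^ 2) = 0)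
    (iη : Integrable (fun y => (1 - p y ^ 2 - q y ^ 2) ^ 2))
    (ip0 : Integrable (fun y => D 0 p y ^ 2)) (ip1 : Integrable (fun y => D 1 p y ^ 2))
    (iq0 : Integrable (fun y => D 0 q y ^ 2)) (iq1 : Integrable (fun y => D 1 q y ^ 2)) :
    ∀ y, D 0 p y = 0 ∧ D 1 p y = 0 ∧ D 0 q y = 0 ∧ D 1 q y = 0 := by
  have h2 : (0:ℝ) < Real.sqrt 2 := by positivity
  have hcp : 0 < c := h2.trans_le hc
  have hc2 : 2 ≤ c ^ 2 := by
    have := Real.sq_sqrt (show (0:ℝ) ≤ 2 by norm_num)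
    nlinarith
  set n1 := Real.sqrt (1 - 2 / c ^ 2) with hn1
  set n2 := Real.sqrt 2 / c with hn2
  have s2 : n2 ^ 2 = 2 / c ^ 2 := by
    rw [hn2, div_pow, Real.sq_sqrt (by norm_num)]
  have hle : 2 / c ^ 2 ≤ 1 := by rw [div_le_one (by positivity)]; exact hc2
  have s1 : n1 ^ 2 = 1 - 2 / c ^ 2 := Real.sq_sqrt (by linarith)
  have n2p : 0 < n2 := by positivity
  have hn : n1 ^ 2 + n2 ^ 2 = 1 := by rw [s1, s2]; ring
  have hcn : c ^ 2 * n2 ^ 2 = 2 := by rw [s2]; field_simp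
  have hz := limit_id c n1 n2 hn hcn p q hp hq e1 e2 iη ip0 ip1 iq0 iq1
  have cp0 : Continuous (D 0 p) := (D_smooth (m := 1) hp (by norm_num)).continuous
  have cp1 : Continuous (D 1 p) := (D_smooth (m := 1) hp (by norm_num)).continuous
  have cq0 : Continuous (D 0 q) := (D_smooth (m := 1) hq (by norm_num)).continuous
  have cq1 : Continuous (D 1 q) := (D_smooth (m := 1) hq (by norm_num)).continuous
  have cp := hp.continuous
  have cq := hq.continuous
  set H : Euc 2 → ℝ := fun y => 2 * (D 0 p y ^ 2 + (n1 * D 0 p y + n2 * D 1 p y) ^ 2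
    + D 0 q y ^ 2 + (n1 * D 0 q y + n2 * D 1 q y) ^ 2)
    + (1 + n2 ^ 2) * (1 - p y ^ 2 - q y ^ 2) ^ 2 with hH
  have hHz : ∫ y, H y = 0 := by
    rw [← hz]
    congr 1
    ext y
    simp only [hH]
    linear_combination (2 * (D 1 p y ^ 2 + D 1 q y ^ 2) + (1 - p y ^ 2 - q y ^ 2) ^ 2) * hn
  have hHc : Continuous H := by rw [hH]; fun_prop
  have hH0 : ∀ y, 0 ≤ H y := fun y => by simp only [hH]; positivity
  have hHi : Integrable H := by
    have iG := ((((ip0.add ip1).add iq0).add iq1).add iη).const_mul 8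
    refine iG.mono' hHc.aestronglyMeasurable (Eventually.of_forall fun y => ?_)
    rw [Real.norm_of_nonneg (hH0 y)]
    simp only [hH, Pi.add_apply]
    have a1 : ∀ a b : ℝ, (n1 * a + n2 * b) ^ 2 ≤ a ^ 2 + b ^ 2 := fun a b => by
      have : a ^ 2 + b ^ 2 - (n1 * a + n2 * b) ^ 2 = (n2 * a - n1 * b) ^ 2 := by
        linear_combination (-(a ^ 2 + b ^ 2)) * hn
      have h5 := sq_nonneg (n2 * a - n1 * b)
      linarith
    have b1 := a1 (D 0 p y) (D 1 p y)
    have b2 := a1 (D 0 q y) (D 1 q y)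
    have b3 : n2 ^ 2 ≤ 1 := by rw [s2]; exact hle
    have b4 : n2 ^ 2 * (1 - p y ^ 2 - q y ^ 2) ^ 2 ≤ (1 - p y ^ 2 - q y ^ 2) ^ 2 :=
      mul_le_of_le_one_left (sq_nonneg _) b3
    have c1 := sq_nonneg (D 0 p y)
    have c2 := sq_nonneg (D 1 p y)
    have c3 := sq_nonneg (D 0 q y)
    have c4 := sq_nonneg (D 1 q y)
    have c5 := sq_nonneg (1 - p y ^ 2 - q y ^ 2)
    generalize (1 - p y ^ 2 - q y ^ 2) ^ 2 = w at *
    generalize (n1 * D 0 p y + n2 * D 1 p y) ^ 2 = w1 at *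
    generalize (n1 * D 0 q y + n2 * D 1 q y) ^ 2 = w2 at *
    have b5 : (1 + n2 ^ 2) * w = w + n2 ^ 2 * w := by ring
    rw [b5]
    linarith
  have hHe : H = 0 := by
    have h1 := (integral_eq_zero_iff_of_nonneg hH0 hHi).1 hHz
    exact (hHc.ae_eq_iff_eq volume continuous_zero).1 h1
  intro y
  have hy : H y = 0 := congrFun hHe y
  simp only [hH] at hy
  have q5 : 0 ≤ (1 + n2 ^ 2) * (1 - p y ^ 2 - q y ^ 2) ^ 2 := by positivity
  have d1 := sq_nonneg (D 0 p y)
  have d2 := sq_nonneg (n1 * D 0 p y + n2 * D 1 p y)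
  have d3 := sq_nonneg (D 0 q y)
  have d4 := sq_nonneg (n1 * D 0 q y + n2 * D 1 q y)
  have aux : ∀ a b e f g : ℝ, 0 ≤ a → 0 ≤ b → 0 ≤ e → 0 ≤ f → 0 ≤ g →
      2 * (a + b + e + f) + g = 0 → a = 0 ∧ b = 0 ∧ e = 0 ∧ f = 0 := by
    intro a b e f g h1 h2 h3 h4 h5 h6
    refine ⟨?_, ?_, ?_, ?_⟩ <;> linarith
  obtain ⟨r1, r2, r3, r4⟩ := aux _ _ _ _ _ d1 d2 d3 d4 q5 hy
  have z1 : D 0 p y = 0 := sq_eq_zero_iff.1 r1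
  have z2 : D 0 q y = 0 := sq_eq_zero_iff.1 r3
  have z3 : n2 * D 1 p y = 0 := by
    have h := sq_eq_zero_iff.1 r2
    rwa [z1, mul_zero, zero_add] at h
  have z4 : n2 * D 1 q y = 0 := by
    have h := sq_eq_zero_iff.1 r4
    rwa [z2, mul_zero, zero_add] at h
  exact ⟨z1, (mul_eq_zero.1 z3).resolve_left n2p.ne', z2, (mul_eq_zero.1 z4).resolve_left n2p.ne'⟩

lemma D_re {U : Euc 2 → ℂ} (hU : Differentiable ℝ U) (k : Fin 2) :
    D k (fun y => (U y).re) = fun y => (fderiv ℝ U y (basisVec k)).re := by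
  ext y
  have h : HasFDerivAt (fun y => (U y).re) (Complex.reCLM.comp (fderiv ℝ U y)) y :=
    Complex.reCLM.hasFDerivAt.comp y (hU y).hasFDerivAt
  unfold D
  rw [h.fderiv]; rfl

lemma D_im {U : Euc 2 → ℂ} (hU : Differentiable ℝ U) (k : Fin 2) :
    D k (fun y => (U y).im) = fun y => (fderiv ℝ U y (basisVec k)).im := by
  ext y
  have h : HasFDerivAt (fun y => (U y).im) (Complex.imCLM.comp (fderiv ℝ U y)) y :=
    Complex.imCLM.hasFDerivAt.comp y (hU y).hasFDerivAt
  unfold D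
  rw [h.fderiv]; rfl

end TW

/-- For `c ≥ √2` there are no nonconstant finite-energy traveling waves
of the Gross–Pitaevskii equation in `ℝ²` with `|U| → 1` at infinity. -/
theorem statement11 (c : ℝ) (hc : Real.sqrt 2 ≤ c) (U : Euc 2 → ℂ)
    (hTW : IsTravelingWave c U)
    (hE : glEnergy U < ⊤)
    (hmod : Tendsto (fun y : Euc 2 => ‖U y‖) (Filter.cocompact (Euc 2)) (nhds 1)) :
    ∃ z : ℂ, ∀ y : Euc 2, U y = z := by
  obtain ⟨hU, heq⟩ := hTW
  have dU : Differentiable ℝ U := hU.differentiable (by norm_num)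
  have cdU : Continuous (fderiv ℝ U) := hU.continuous_fderiv (by norm_num)
  have cU := hU.continuous
  have dU1 : ∀ k : Fin 2, Differentiable ℝ (fun y => fderiv ℝ U y (basisVec k)) := fun k =>
    ((hU.fderiv_right (m := 1) (by norm_num)).clm_apply contDiff_const).differentiable
      (by norm_num)
  have hp : ContDiff ℝ 2 (fun y => (U y).re) := Complex.reCLM.contDiff.comp hU
  have hq : ContDiff ℝ 2 (fun y => (U y).im) := Complex.imCLM.contDiff.comp hU
  have hnorm : ∀ y, ‖U y‖ ^ 2 = (U y).re ^ 2 + (U y).im ^ 2 := fun y => by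
    rw [Complex.sq_norm, Complex.normSq_apply]; ring
  have hη : ∀ y, (1 - (‖U y‖ : ℂ) ^ 2) = ((1 - (U y).re ^ 2 - (U y).im ^ 2 : ℝ) : ℂ) := fun y => by
    rw [show (1 - (U y).re ^ 2 - (U y).im ^ 2 : ℝ) = 1 - ‖U y‖ ^ 2 by rw [hnorm]; ring]
    push_cast; rfl
  -- integrability
  have hfin : ∀ (F : Euc 2 → ℝ) (C : ℝ≥0∞), C ≠ ⊤ → Continuous F → (∀ y, ENNReal.ofReal (F y) ≤
      C * ((‖fderiv ℝ U y‖₊ : ℝ≥0∞) ^ 2 / 2 + (‖1 - ‖U y‖ ^ 2‖₊ : ℝ≥0∞) ^ 2 / 4)) →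
      (∀ y, 0 ≤ F y) → Integrable F := by
    intro F C hC hF hb h0
    refine ⟨hF.aestronglyMeasurable, ?_⟩
    rw [hasFiniteIntegral_iff_ofReal (Eventually.of_forall h0)]
    refine (lintegral_mono hb).trans_lt ?_
    rw [lintegral_const_mul' _ _ hC]
    exact ENNReal.mul_lt_top hC.lt_top hE
  have conv : ∀ (a b : ℝ≥0), ((a : ℝ≥0∞) ^ 2 / 2 + (b : ℝ≥0∞) ^ 2 / 4)
      = ((a ^ 2 / 2 + b ^ 2 / 4 : ℝ≥0) : ℝ≥0∞) := by
    intro a b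
    push_cast [ENNReal.coe_div]
    norm_num
  have hfin' : ∀ (F : Euc 2 → ℝ), Continuous F → (∀ y, 0 ≤ F y) →
      (∀ y, F y ≤ 4 * (‖fderiv ℝ U y‖ ^ 2 / 2 + (1 - ‖U y‖ ^ 2) ^ 2 / 4)) → Integrable F := by
    intro F hF h0 hb
    refine hfin F ((4 : ℝ≥0) : ℝ≥0∞) ENNReal.coe_ne_top hF (fun y => ?_) h0
    rw [conv, ← ENNReal.coe_mul, ENNReal.ofReal, ENNReal.coe_le_coe]
    rw [Real.toNNReal_le_iff_le_coe]
    push_cast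
    simpa using hb y
  have nb : ∀ k : Fin 2, ‖(basisVec k : Euc 2)‖ = 1 := fun k => by simp [basisVec]
  have hbd : ∀ (k : Fin 2) y, ‖fderiv ℝ U y (basisVec k)‖ ≤ ‖fderiv ℝ U y‖ := fun k y => by
    have := (fderiv ℝ U y).le_opNorm (basisVec k)
    rwa [nb, mul_one] at this
  have ip : ∀ k, Integrable (fun y => TW.D k (fun y => (U y).re) y ^ 2) := by
    intro k
    have hcont : Continuous (TW.D k (fun y => (U y).re)) :=
      (TW.D_smooth (m := 1) hp (by norm_num)).continuous
    refine hfin' _ (hcont.pow 2) (fun y => sq_nonneg _) fun y => ?_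
    rw [TW.D_re dU]
    have h1 := (Complex.abs_re_le_norm _).trans (hbd k y)
    have h2 := sq_le_sq₀ (abs_nonneg _) (norm_nonneg _) |>.2 h1
    rw [sq_abs] at h2
    nlinarith [sq_nonneg (1 - ‖U y‖ ^ 2), sq_nonneg ‖fderiv ℝ U y‖]
  have iq : ∀ k, Integrable (fun y => TW.D k (fun y => (U y).im) y ^ 2) := by
    intro k
    have hcont : Continuous (TW.D k (fun y => (U y).im)) :=
      (TW.D_smooth (m := 1) hq (by norm_num)).continuous
    refine hfin' _ (hcont.pow 2) (fun y => sq_nonneg _) fun y => ?_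
    rw [TW.D_im dU]
    have h1 := (Complex.abs_im_le_norm _).trans (hbd k y)
    have h2 := sq_le_sq₀ (abs_nonneg _) (norm_nonneg _) |>.2 h1
    rw [sq_abs] at h2
    nlinarith [sq_nonneg (1 - ‖U y‖ ^ 2), sq_nonneg ‖fderiv ℝ U y‖]
  have iη : Integrable (fun y => (1 - (U y).re ^ 2 - (U y).im ^ 2) ^ 2) := by
    refine hfin' _ ?_ (fun y => sq_nonneg _) fun y => ?_
    · have := hp.continuous
      have := hq.continuous
      fun_prop
    · rw [hnorm]
      nlinarith [sq_nonneg ‖fderiv ℝ U y‖]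
  have key := TW.rigid c hc (fun y => (U y).re) (fun y => (U y).im) hp hq
    (by
      intro y
      have h := congrArg Complex.re (heq y)
      rw [hη] at h
      simp only [TW.D_re dU, TW.D_re (dU1 _), TW.D_im dU]
      simp only [lap, Fin.sum_univ_two, e2, Complex.add_re, Complex.mul_re, Complex.mul_im,
        Complex.I_re, Complex.I_im, Complex.ofReal_re, Complex.ofReal_im, Complex.zero_re] at h
      linarith)
    (by
      intro y
      have h := congrArg Complex.im (heq y)
      rw [hη] at h
      simp only [TW.D_im dU, TW.D_im (dU1 _), TW.D_re dU]
      simp only [lap, Fin.sum_univ_two, e2, Complex.add_im, Complex.mul_re, Complex.mul_im,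
        Complex.I_re, Complex.I_im, Complex.ofReal_re, Complex.ofReal_im, Complex.zero_im] at h
      linarith)
    iη (ip 0) (ip 1) (iq 0) (iq 1)
  have hzero : ∀ y, fderiv ℝ U y = 0 := by
    intro y
    obtain ⟨k1, k2, k3, k4⟩ := key y
    rw [TW.D_re dU] at k1 k2
    rw [TW.D_im dU] at k3 k4
    have v0 : fderiv ℝ U y (basisVec 0) = 0 := Complex.ext k1 k3
    have v1 : fderiv ℝ U y (basisVec 1) = 0 := Complex.ext k2 k4
    ext v
    have hv : v = v 0 • (basisVec 0 : Euc 2) + v 1 • (basisVec 1 : Euc 2) := by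
      ext i
      fin_cases i <;> simp [basisVec]
    rw [hv, map_add, map_smul, map_smul, v0, v1]
    simp
  exact ⟨U 0, fun y => is_const_of_fderiv_eq_zero dU hzero y 0⟩
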